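/- arXiv:2405.17415 — 2 statements merged into one kernel-verified Lean document; each statement's English description precedes it below -/
import Mathlib

section
/- Let D be a k-dimensional singular holomorphic distribution on a polydisc U ⊂ ℂ^n, defined by a single holomorphic (n−k)-form ω on U with codim(sing(ω)) ≥ 2, and let X_1, …, X_k be holomorphic vector fields on U, each with singular set of codimension ≥ 2, defining one-dimensional foliations G_1, …, G_k respectively. Then the following are equivalent: (a) T_D = T_{G_1} ⊕ ⋯ ⊕ T_{G_k}; (b) ω = i_{X_1} ⋯ i_{X_k} Θ for some holomorphic n-form Θ on U. -/
open Topology Filter Set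
open scoped ENNReal Manifold

noncomputable section

/-- `ℂⁿ`. -/
abbrev Cn (n : ℕ) : Type := Fin n → ℂ

/-- Holomorphic `m`-forms on (open subsets of) `ℂⁿ`, as alternating-map valued functions. -/
abbrev Form (n m : ℕ) : Type := Cn n → AlternatingMap ℂ (Cn n) ℂ (Fin m)

/-- Vector fields on (open subsets of) `ℂⁿ`. -/
abbrev VF (n : ℕ) : Type := Cn n → Cn n

/-- A form is holomorphic on `U` if all its coefficient functions are. -/
def HolFormOn {n m : ℕ} (U : Set (Cn n)) (ω : Form n m) : Prop :=
  ∀ v : Fin m → Cn n, AnalyticOnNhd ℂ (fun z => ω z v) U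

/-- A form is holomorphic at (a neighborhood of) a point `c`. -/
def HolFormAt {n m : ℕ} (c : Cn n) (ω : Form n m) : Prop :=
  ∀ v : Fin m → Cn n, AnalyticAt ℂ (fun z => ω z v) c

/-- The zero locus (singular set) of a form. -/
def zeroLocus {n m : ℕ} (ω : Form n m) : Set (Cn n) := {z | ω z = 0}

/-- `V ⊆ ℂⁿ` has (complex) codimension at least `c`; via Hausdorff dimension
(a complex-analytic set of complex dimension `d` has Hausdorff dimension `2d`).
The empty set has codimension `≥ c` for every `c`. -/
def CodimGE (n : ℕ) (V : Set (Cn n)) (c : ℕ) : Prop :=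
  V = ∅ ∨ dimH V + 2 * (c : ℝ≥0∞) ≤ 2 * (n : ℝ≥0∞)

/-- The germ of `V` at `c` has codimension at least `k`. -/
def GermCodimGE (n : ℕ) (c : Cn n) (V : Set (Cn n)) (k : ℕ) : Prop :=
  ∃ U ∈ 𝓝 c, CodimGE n (V ∩ U) k

/-- `i_X (ω) = 0` at the point `z` : the form `ω` annihilates the vector `X z` at `z`. -/
def TangentAt {n m : ℕ} (ω : Form n m) (X : VF n) (z : Cn n) : Prop :=
  ∀ (v : Fin m → Cn n) (i : Fin m), v i = X z → ω z v = 0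

/-- `ω` is locally decomposable (as a wedge of holomorphic `1`-forms) at the points
of `U` where it does not vanish. -/
def LocallyDecomp {n m : ℕ} (U : Set (Cn n)) (ω : Form n m) : Prop :=
  ∀ z ∈ U, ω z ≠ 0 → ∃ W ∈ 𝓝 z, W ⊆ U ∧ ∃ η : Fin m → Cn n → (Cn n →ₗ[ℂ] ℂ),
    (∀ i (v : Cn n), AnalyticOnNhd ℂ (fun w => η i w v) W) ∧
    ∀ w ∈ W, ∀ v : Fin m → Cn n, ω w v = Matrix.det (Matrix.of fun i j => η i w (v j))

/-- The rank of the derivative (linear part) of a vector field at a point. -/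
def rkAt {n : ℕ} (X : VF n) (z : Cn n) : ℕ :=
  Module.finrank ℂ (LinearMap.range (fderiv ℂ X z).toLinearMap)

/-- The germ at `c` of the vector field `X` divides the germ of the `m`-form `ω`:
`ω = i_X Θ` for some germ of holomorphic `(m+1)`-form `Θ`. -/
def DividesAt {n m : ℕ} (X : VF n) (ω : Form n m) (c : Cn n) : Prop :=
  ∃ Θ : Form n (m + 1), HolFormAt c Θ ∧
    ∀ᶠ z in 𝓝 c, ∀ v : Fin m → Cn n, ω z v = Θ z (Fin.cons (X z) v)

/-- The germ at `0` of an `m`-form defines a singular holomorphic distribution: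
it is holomorphic, locally decomposable outside its zero set, and its zero set has
codimension at least two. -/
structure IsGermDist (n m : ℕ) (ω : Form n m) : Prop where
  hol : ∃ U ∈ 𝓝 (0 : Cn n), HolFormOn U ω ∧ LocallyDecomp U ω
  codim : GermCodimGE n 0 (zeroLocus ω) 2

/-- The tangent sheaf of the germ of two-dimensional distribution defined by the
`m`-form `ω` (`m = n - 2`) is locally free: `ω = i_Y i_Z Θ` for germs of vector fields
`Y, Z` and a germ of `n`-form `Θ`. -/
def GermLocFree2 (n m : ℕ) (ω : Form n m) : Prop :=
  ∃ (Y Z : VF n) (Θ : Form n (m + 2)), AnalyticAt ℂ Y 0 ∧ AnalyticAt ℂ Z 0 ∧ HolFormAt 0 Θ ∧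
    ∀ᶠ z in 𝓝 (0 : Cn n), ∀ v : Fin m → Cn n,
      ω z v = Θ z (Fin.cons (Y z) (Fin.cons (Z z) v))

/-- `ω = i_X i_Y Θ` near `0`, for some germ of vector field `Y` and germ of `n`-form `Θ`. -/
def DivPairAt {n m : ℕ} (X : VF n) (ω : Form n m) : Prop :=
  ∃ (Y : VF n) (Θ : Form n (m + 2)), AnalyticAt ℂ Y 0 ∧ HolFormAt 0 Θ ∧
    ∀ᶠ z in 𝓝 (0 : Cn n), ∀ v : Fin m → Cn n,
      ω z v = Θ z (Fin.cons (X z) (Fin.cons (Y z) v))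

/-- The tangent sheaf of the germ of `k`-dimensional distribution defined by the `m`-form
`ω` (`n = k + m`) is locally free: `ω = i_{X_1} ⋯ i_{X_k} Θ`. -/
def GermLocFreeK (n k m : ℕ) (h : n = k + m) (ω : Form n m) : Prop :=
  ∃ (Xs : Fin k → VF n) (Θ : Form n n), (∀ i, AnalyticAt ℂ (Xs i) 0) ∧ HolFormAt 0 Θ ∧
    ∀ᶠ z in 𝓝 (0 : Cn n), ∀ v : Fin m → Cn n,
      ω z v = Θ z (fun i => Fin.append (fun a => Xs a z) v (Fin.cast h i))

/-- The germs at `c` of the vector fields `Xs` freely generate the germs of vector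
fields tangent to the distribution defined by `ω` : every germ of tangent vector field
is a combination of the `Xs` with holomorphic coefficients, and the coefficients in such
combinations are unique (i.e. the `Xs` are independent over the local ring at `c`). -/
def FreeGensAt {n m : ℕ} (ω : Form n m) {k : ℕ} (Xs : Fin k → VF n) (c : Cn n) : Prop :=
  (∀ Z : VF n, AnalyticAt ℂ Z c → (∀ᶠ z in 𝓝 c, TangentAt ω Z z) →
      ∃ f : Fin k → Cn n → ℂ, (∀ i, AnalyticAt ℂ (f i) c) ∧
        ∀ᶠ z in 𝓝 c, Z z = ∑ i, f i z • Xs i z) ∧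
  (∀ f : Fin k → Cn n → ℂ, (∀ i, AnalyticAt ℂ (f i) c) →
      (∀ᶠ z in 𝓝 c, (∑ i, f i z • Xs i z) = 0) → ∀ i, ∀ᶠ z in 𝓝 c, f i z = 0)

/-- Polydiscs in `ℂⁿ`. -/
def IsPolydisc {n : ℕ} (U : Set (Cn n)) : Prop :=
  ∃ (c : Cn n) (r : Fin n → ℝ), (∀ i, 0 < r i) ∧ U = {z | ∀ i, dist (z i) (c i) < r i}

/-- The wedge product of a `1`-form with a `k`-form, as a function of `k+1` vectors. -/
def wedge1 {n k : ℕ} (ω : Form n 1) (α : Form n k) (z : Cn n) (v : Fin (k + 1) → Cn n) : ℂ :=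
  ∑ i : Fin (k + 1), (-1 : ℂ) ^ (i : ℕ) * ω z (fun _ => v i) * α z (fun j => v (i.succAbove j))

/-! ### Analytic subsets of open sets of `ℂᴺ`, irreducibility, components -/

/-- `V` is an analytic subset of `U`: locally (on `U`) it is the common zero set of
finitely many holomorphic functions. -/
def IsAnalyticIn {N : ℕ} (U V : Set (Cn N)) : Prop :=
  V ⊆ U ∧ ∀ p ∈ U, ∃ W ∈ 𝓝 p, ∃ (r : ℕ) (f : Fin r → Cn N → ℂ),
    (∀ i, AnalyticOnNhd ℂ (f i) W) ∧ ∀ z ∈ W ∩ U, (z ∈ V ↔ ∀ i, f i z = 0)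

/-- An irreducible analytic subset of `U`. -/
def IsIrredAnalyticIn {N : ℕ} (U V : Set (Cn N)) : Prop :=
  IsAnalyticIn U V ∧ V.Nonempty ∧
    ∀ V1 V2, IsAnalyticIn U V1 → IsAnalyticIn U V2 → V = V1 ∪ V2 → V = V1 ∨ V = V2

/-- `C` is an irreducible component of the analytic set `V ⊆ U` : a maximal irreducible
analytic subset of `U` contained in `V`. -/
def IsIrredComponentIn {N : ℕ} (U V C : Set (Cn N)) : Prop :=
  IsIrredAnalyticIn U C ∧ C ⊆ V ∧ ∀ C', IsIrredAnalyticIn U C' → C ⊆ C' → C' ⊆ V → C' = C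

/-! ### Distributions and foliations on `ℙⁿ`, in homogeneous coordinates -/

/-- A `k`-dimensional singular holomorphic distribution of degree `d` on `ℙⁿ`, given in
homogeneous coordinates by a homogeneous `(n-k)`-form `ω` on `ℂⁿ⁺¹` (with polynomial
coefficients of degree `d+1`) satisfying `i_R ω = 0`, locally decomposable outside its
singular set, whose singular set has codimension at least `2`. -/
structure ProjDist (n k : ℕ) where
  d : ℕ
  ω : Form (n + 1) (n - k)
  hol : HolFormOn Set.univ ω
  homog : ∀ (t : ℂ) (z : Cn (n + 1)) (v : Fin (n - k) → Cn (n + 1)),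
    ω (t • z) v = t ^ (d + 1) * ω z v
  radial : ∀ (z : Cn (n + 1)) (v : Fin (n - k) → Cn (n + 1)) (i : Fin (n - k)),
    v i = z → ω z v = 0
  decomp : LocallyDecomp Set.univ ω
  codim : CodimGE (n + 1) {z | z ≠ 0 ∧ ω z = 0} 2

/-- The singular set of a distribution on `ℙⁿ`, as a cone in `ℂⁿ⁺¹ \ {0}`. -/
def ProjDist.coneSing {n k : ℕ} (D : ProjDist n k) : Set (Cn (n + 1)) :=
  {z | z ≠ 0 ∧ D.ω z = 0}

/-- A one-dimensional singular holomorphic foliation of degree `d` on `ℙⁿ`, given in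
homogeneous coordinates by a homogeneous polynomial vector field on `ℂⁿ⁺¹`, whose
singular set (points where `V ∧ R = 0`) has codimension at least `2`. -/
structure ProjFol1 (n : ℕ) where
  d : ℕ
  V : VF (n + 1)
  hol : AnalyticOnNhd ℂ V Set.univ
  homog : ∀ (t : ℂ) (z : Cn (n + 1)), V (t • z) = t ^ d • V z
  codim : CodimGE (n + 1) {z | z ≠ 0 ∧ V z ∈ Submodule.span ℂ {z}} 2

/-- The singular set of a one-dimensional foliation on `ℙⁿ`, as a cone in `ℂⁿ⁺¹ \ {0}`. -/
def ProjFol1.coneSing {n : ℕ} (G : ProjFol1 n) : Set (Cn (n + 1)) :=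
  {z | z ≠ 0 ∧ G.V z ∈ Submodule.span ℂ {z}}

/-- The foliation `G` is tangent to the distribution `D` : `i_V ω = 0`. -/
def PTangent {n k : ℕ} (G : ProjFol1 n) (D : ProjDist n k) : Prop :=
  ∀ (z : Cn (n + 1)) (v : Fin (n - k) → Cn (n + 1)) (i : Fin (n - k)),
    v i = G.V z → D.ω z v = 0

/-- `G` locally divides the two-dimensional distribution `D` at the point of `ℙⁿ`
corresponding to `q ∈ ℂⁿ⁺¹ \ {0}` : in homogeneous coordinates, `ω = i_V i_R Θ` near `q`
for some germ of holomorphic `(n-1)`-form `Θ` (equivalently, in an affine chart at `[q]`,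
the defining vector field of `G` divides the defining form of `D`). -/
def PLocDividesAt {n : ℕ} (G : ProjFol1 n) (D : ProjDist n 2) (q : Cn (n + 1)) : Prop :=
  ∃ Θ : Form (n + 1) (n - 2 + 2), HolFormAt q Θ ∧
    ∀ᶠ z in 𝓝 q, ∀ v : Fin (n - 2) → Cn (n + 1),
      D.ω z v = Θ z (Fin.cons (G.V z) (Fin.cons z v))

/-- The tangent sheaf of the two-dimensional distribution `D` on `ℙⁿ` is locally free:
near every point of `ℂⁿ⁺¹ \ {0}` one can write `ω = i_X i_Y i_R Θ`. -/
def PLocFreeAt {n : ℕ} (D : ProjDist n 2) (q : Cn (n + 1)) : Prop :=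
  ∃ (X Y : VF (n + 1)) (Θ : Form (n + 1) (n - 2 + 3)),
    AnalyticAt ℂ X q ∧ AnalyticAt ℂ Y q ∧ HolFormAt q Θ ∧
    ∀ᶠ z in 𝓝 q, ∀ v : Fin (n - 2) → Cn (n + 1),
      D.ω z v = Θ z (Fin.cons (X z) (Fin.cons (Y z) (Fin.cons z v)))

def PLocFree {n : ℕ} (D : ProjDist n 2) : Prop :=
  ∀ q : Cn (n + 1), q ≠ 0 → PLocFreeAt D q

/-- The linearization, at a singular point `q` (with `ℓ q = 1`), of the vector field
induced on the affine chart `{ℓ = 1}` of `ℙⁿ` by the homogeneous vector field `V`. -/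
def projLin {n : ℕ} (V : VF n) (q : Cn n) (ℓ : Cn n →ₗ[ℂ] ℂ) : Cn n →ₗ[ℂ] Cn n :=
  (fderiv ℂ V q).toLinearMap - LinearMap.smulRight (ℓ ∘ₗ (fderiv ℂ V q).toLinearMap) q
    - ℓ (V q) • LinearMap.id

/-- The linear rank of the one-dimensional foliation `G` on `ℙⁿ` is at least `r` :
at every singular point, the linearization of the vector field induced on an affine
chart has rank at least `r`. -/
def PLinRankGE {n : ℕ} (G : ProjFol1 n) (r : ℕ) : Prop :=
  ∀ q ∈ G.coneSing, ∃ ℓ : Cn (n + 1) →ₗ[ℂ] ℂ, ℓ q = 1 ∧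
    r ≤ Module.finrank ℂ (Submodule.map (projLin G.V q ℓ) (LinearMap.ker ℓ))

/-- `T_D = T_G ⊕ T_H` : in homogeneous coordinates,
`ω = c ⋅ i_{V_G} i_{V_H} i_R (dx_0 ∧ ⋯ ∧ dx_n)` for a nonzero constant `c`. -/
def SplitPair {n : ℕ} (hn : n + 1 = 3 + (n - 2)) (G H : ProjFol1 n) (D : ProjDist n 2) :
    Prop :=
  ∃ c : ℂ, c ≠ 0 ∧ ∀ (z : Cn (n + 1)) (v : Fin (n - 2) → Cn (n + 1)),
    D.ω z v = c * Matrix.det (Matrix.of fun i j =>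
      Fin.append ![G.V z, H.V z, z] v (Fin.cast hn i) j)

/-- The tangent sheaf of the two-dimensional distribution `D` on `ℙⁿ` splits as a direct
sum of two line bundles: `ω = c ⋅ i_{X_1} i_{X_2} i_R (dx_0 ∧ ⋯ ∧ dx_n)` for homogeneous
polynomial vector fields `X_1, X_2` on `ℂⁿ⁺¹`. -/
def PSplits {n : ℕ} (hn : n + 1 = 3 + (n - 2)) (D : ProjDist n 2) : Prop :=
  ∃ (X1 X2 : VF (n + 1)) (d1 d2 : ℕ) (c : ℂ), c ≠ 0 ∧
    AnalyticOnNhd ℂ X1 Set.univ ∧ AnalyticOnNhd ℂ X2 Set.univ ∧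
    (∀ (t : ℂ) (z : Cn (n + 1)), X1 (t • z) = t ^ d1 • X1 z) ∧
    (∀ (t : ℂ) (z : Cn (n + 1)), X2 (t • z) = t ^ d2 • X2 z) ∧
    ∀ (z : Cn (n + 1)) (v : Fin (n - 2) → Cn (n + 1)),
      D.ω z v = c * Matrix.det (Matrix.of fun i j =>
        Fin.append ![X1 z, X2 z, z] v (Fin.cast hn i) j)

/-- The coefficient of the exterior differential of a `1`-form: `dω(a,b)` at `z`. -/
def extd1 {N : ℕ} (ω : Form N 1) (z a b : Cn N) : ℂ :=
  fderiv ℂ (fun y => ω y ![b]) z a - fderiv ℂ (fun y => ω y ![a]) z b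

/-- The Frobenius integrability condition `ω ∧ dω = 0` for a `1`-form. -/
def Integrable1 {N : ℕ} (ω : Form N 1) : Prop :=
  ∀ z a b c : Cn N,
    ω z ![a] * extd1 ω z b c + ω z ![b] * extd1 ω z c a + ω z ![c] * extd1 ω z a b = 0

/-! ### Distributions and foliations on complex manifolds -/

section Manifold

variable {n k : ℕ} {M : Type*} [TopologicalSpace M] [ChartedSpace (Cn n) M]

/-- A `k`-dimensional singular holomorphic distribution on a complex `n`-manifold `M`:
around each point it is given, in the chart at that point, by a holomorphic `(n-k)`-form,
locally decomposable outside its zero set, with zero set of codimension at least 2;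
on overlaps the local forms agree up to a nonvanishing holomorphic factor. -/
structure MDist (n k : ℕ) (M : Type*) [TopologicalSpace M] [ChartedSpace (Cn n) M] where
  ω : M → Form n (n - k)
  dom : M → Set (Cn n)
  dom_open : ∀ p, IsOpen (dom p)
  dom_sub : ∀ p, dom p ⊆ (chartAt (Cn n) p).target
  dom_mem : ∀ p, chartAt (Cn n) p p ∈ dom p
  hol : ∀ p, HolFormOn (dom p) (ω p)
  decomp : ∀ p, LocallyDecomp (dom p) (ω p)
  codim : ∀ p, CodimGE n (zeroLocus (ω p) ∩ dom p) 2
  compat : ∀ p q : M, ∀ x : M, x ∈ (chartAt (Cn n) p).source → x ∈ (chartAt (Cn n) q).source →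
    chartAt (Cn n) p x ∈ dom p → chartAt (Cn n) q x ∈ dom q →
    ∃ W ∈ 𝓝 (chartAt (Cn n) p x), W ⊆ dom p ∧
      ∃ h : Cn n → ℂ, AnalyticOnNhd ℂ h W ∧ (∀ z ∈ W, h z ≠ 0) ∧
      ∀ z ∈ W, ∀ v : Fin (n - k) → Cn n,
        ω p z v = h z * ω q ((chartAt (Cn n) q) ((chartAt (Cn n) p).symm z))
          (fun i => fderiv ℂ (fun y => (chartAt (Cn n) q) ((chartAt (Cn n) p).symm y)) z (v i))

/-- The singular set of a distribution on a manifold. -/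
def MDist.sing (D : MDist n k M) : Set M :=
  {x | D.ω x (chartAt (Cn n) x x) = 0}

/-- A one-dimensional singular holomorphic foliation on a complex `n`-manifold `M`:
around each point it is given, in the chart at that point, by a holomorphic vector field
with singular set of codimension at least 2; on overlaps the local vector fields agree,
up to a nonvanishing holomorphic factor, under the differentials of the transition maps. -/
structure MFol1 (n : ℕ) (M : Type*) [TopologicalSpace M] [ChartedSpace (Cn n) M] where
  V : M → VF n
  dom : M → Set (Cn n)
  dom_open : ∀ p, IsOpen (dom p)
  dom_sub : ∀ p, dom p ⊆ (chartAt (Cn n) p).target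
  dom_mem : ∀ p, chartAt (Cn n) p p ∈ dom p
  hol : ∀ p, AnalyticOnNhd ℂ (V p) (dom p)
  codim : ∀ p, CodimGE n ({z ∈ dom p | V p z = 0}) 2
  compat : ∀ p q : M, ∀ x : M, x ∈ (chartAt (Cn n) p).source → x ∈ (chartAt (Cn n) q).source →
    chartAt (Cn n) p x ∈ dom p → chartAt (Cn n) q x ∈ dom q →
    ∃ W ∈ 𝓝 (chartAt (Cn n) p x), W ⊆ dom p ∧
      ∃ h : Cn n → ℂ, AnalyticOnNhd ℂ h W ∧ (∀ z ∈ W, h z ≠ 0) ∧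
      ∀ z ∈ W,
        fderiv ℂ (fun y => (chartAt (Cn n) q) ((chartAt (Cn n) p).symm y)) z (V p z)
          = h z • V q ((chartAt (Cn n) q) ((chartAt (Cn n) p).symm z))

/-- The singular set of a one-dimensional foliation on a manifold. -/
def MFol1.sing (G : MFol1 n M) : Set M :=
  {x | G.V x (chartAt (Cn n) x x) = 0}

/-- The foliation `G` is tangent to the distribution `D`. -/
def MTangent (G : MFol1 n M) (D : MDist n k M) : Prop :=
  ∀ p : M, ∀ z ∈ G.dom p ∩ D.dom p, TangentAt (D.ω p) (G.V p) z

/-- `G` locally divides `D` at `p` : in the chart at `p`, the germ of the defining vector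
field of `G` divides the germ of the defining form of `D`. -/
def MLocDividesAt (G : MFol1 n M) (D : MDist n k M) (p : M) : Prop :=
  DividesAt (G.V p) (D.ω p) (chartAt (Cn n) p p)

/-- The linear rank of `G` is at least `r`: at every singular point `p`, the rank of the
derivative at (the chart image of) `p` of the defining vector field is at least `r`. -/
def MLinRankGE (G : MFol1 n M) (r : ℕ) : Prop :=
  ∀ p ∈ MFol1.sing G, r ≤ rkAt (G.V p) (chartAt (Cn n) p p)

/-- The stalk of the tangent sheaf of `D` at `p` is a free module with `r` generators. -/
def MStalkFreeWith (D : MDist n k M) (p : M) (r : ℕ) : Prop :=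
  ∃ Xs : Fin r → VF n, (∀ i, AnalyticAt ℂ (Xs i) (chartAt (Cn n) p p)) ∧
    (∀ i, ∀ᶠ z in 𝓝 (chartAt (Cn n) p p), TangentAt (D.ω p) (Xs i) z) ∧
    FreeGensAt (D.ω p) Xs (chartAt (Cn n) p p)

/-- (a) The tangent sheaf of `D` is locally free of rank `k`: near every point there are
`k` holomorphic tangent vector fields which freely generate every stalk. -/
def MPropA (D : MDist n k M) : Prop :=
  ∀ p : M, ∃ U : Set (Cn n), IsOpen U ∧ chartAt (Cn n) p p ∈ U ∧ U ⊆ D.dom p ∧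
    ∃ Xs : Fin k → VF n, (∀ i, AnalyticOnNhd ℂ (Xs i) U) ∧
      (∀ i, ∀ z ∈ U, TangentAt (D.ω p) (Xs i) z) ∧
      ∀ z ∈ U, FreeGensAt (D.ω p) Xs z

/-- (b) Near every point, `T_D` is the direct sum of the tangent sheaves of `k`
one-dimensional foliations (defined by vector fields with singular set of codim `≥ 2`). -/
def MPropB (D : MDist n k M) : Prop :=
  ∀ p : M, ∃ U : Set (Cn n), IsOpen U ∧ chartAt (Cn n) p p ∈ U ∧ U ⊆ D.dom p ∧
    ∃ Xs : Fin k → VF n, (∀ i, AnalyticOnNhd ℂ (Xs i) U) ∧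
      (∀ i, CodimGE n {z ∈ U | Xs i z = 0} 2) ∧
      (∀ i, ∀ z ∈ U, TangentAt (D.ω p) (Xs i) z) ∧
      ∀ z ∈ U, FreeGensAt (D.ω p) Xs z

/-- (c) Near every point, a form `i_{X_1} ⋯ i_{X_k} Θ` defines `D`. -/
def MPropC (h : n = k + (n - k)) (D : MDist n k M) : Prop :=
  ∀ p : M, ∃ U : Set (Cn n), IsOpen U ∧ chartAt (Cn n) p p ∈ U ∧ U ⊆ D.dom p ∧
    ∃ (Xs : Fin k → VF n) (Θ : Form n n) (u : Cn n → ℂ),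
      (∀ i, AnalyticOnNhd ℂ (Xs i) U) ∧ HolFormOn U Θ ∧
      AnalyticOnNhd ℂ u U ∧ (∀ z ∈ U, u z ≠ 0) ∧
      ∀ z ∈ U, ∀ v : Fin (n - k) → Cn n,
        D.ω p z v = u z * Θ z (fun i => Fin.append (fun a => Xs a z) v (Fin.cast h i))

/-- (d) At every point, a form `i_{X_1} ⋯ i_{X_k} Θ` defines the germ of `D`. -/
def MPropD (h : n = k + (n - k)) (D : MDist n k M) : Prop :=
  ∀ p : M, ∃ (Xs : Fin k → VF n) (Θ : Form n n) (u : Cn n → ℂ),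
    (∀ i, AnalyticAt ℂ (Xs i) (chartAt (Cn n) p p)) ∧ HolFormAt (chartAt (Cn n) p p) Θ ∧
    AnalyticAt ℂ u (chartAt (Cn n) p p) ∧ u (chartAt (Cn n) p p) ≠ 0 ∧
    ∀ᶠ z in 𝓝 (chartAt (Cn n) p p), ∀ v : Fin (n - k) → Cn n,
      D.ω p z v = u z * Θ z (fun i => Fin.append (fun a => Xs a z) v (Fin.cast h i))

/-- (e) Every stalk of `T_D` is a free module with `k` generators. -/
def MPropE (D : MDist n k M) : Prop :=
  ∀ p : M, MStalkFreeWith D p k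

/-- A subset `S` of the complex manifold `M` is analytic: it is closed and locally,
in charts, the common zero set of finitely many holomorphic functions. -/
def MIsAnalytic (n : ℕ) {M : Type*} [TopologicalSpace M] [ChartedSpace (Cn n) M] (S : Set M) : Prop :=
  IsClosed S ∧ ∀ p : M, ∃ W ∈ 𝓝 (chartAt (Cn n) p p), ∃ (r : ℕ) (f : Fin r → Cn n → ℂ),
    (∀ i, AnalyticOnNhd ℂ (f i) W) ∧
    ∀ z ∈ W ∩ (chartAt (Cn n) p).target, ((chartAt (Cn n) p).symm z ∈ S ↔ ∀ i, f i z = 0)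

/-- Irreducible analytic subsets of `M`. -/
def MIrredAnalytic (n : ℕ) {M : Type*} [TopologicalSpace M] [ChartedSpace (Cn n) M] (S : Set M) : Prop :=
  MIsAnalytic n S ∧ S.Nonempty ∧
    ∀ S1 S2 : Set M, MIsAnalytic n S1 → MIsAnalytic n S2 → S = S1 ∪ S2 → S = S1 ∨ S = S2

/-- `C` is an irreducible component of `V ⊆ M`. -/
def MIrredComponentOf (n : ℕ) {M : Type*} [TopologicalSpace M] [ChartedSpace (Cn n) M] (V C : Set M) : Prop :=
  MIrredAnalytic n C ∧ C ⊆ V ∧ ∀ C', MIrredAnalytic n C' → C ⊆ C' → C' ⊆ V → C' = C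

/-- The local dimension of `S ⊆ M` at `p` equals `d` (via Hausdorff dimension of chart
images on small neighborhoods). -/
def MLocDimEq (n : ℕ) {M : Type*} [TopologicalSpace M] [ChartedSpace (Cn n) M] (S : Set M) (p : M) (d : ℕ) : Prop :=
  ∀ᶠ U in (𝓝 p).smallSets,
    dimH (chartAt (Cn n) p '' (S ∩ U ∩ (chartAt (Cn n) p).source)) = ((2 * d : ℕ) : ℝ≥0∞)

/-- The dimension of `S ⊆ M` equals `d`. -/
def MDimEq (n : ℕ) {M : Type*} [TopologicalSpace M] [ChartedSpace (Cn n) M] (S : Set M) (d : ℕ) : Prop :=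
  (∀ p : M, ∀ᶠ U in (𝓝 p).smallSets,
    dimH (chartAt (Cn n) p '' (S ∩ U ∩ (chartAt (Cn n) p).source)) ≤ ((2 * d : ℕ) : ℝ≥0∞)) ∧
  ∃ p : M, MLocDimEq n S p d

end Manifold

end


/-- Pointwise lift of a continuous multilinear map to spaces of continuous functions. -/
noncomputable def liftMulti {E K : Type*} [NormedAddCommGroup E] [NormedSpace ℂ E]
    [TopologicalSpace K] [CompactSpace K] {k : ℕ}
    (p : ContinuousMultilinearMap ℂ (fun _ : Fin k => E) ℂ) :
    ContinuousMultilinearMap ℂ (fun _ : Fin k => C(K, E)) C(K, ℂ) :=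
  MultilinearMap.mkContinuous
    { toFun := fun x => ⟨fun t => p (fun i => x i t),
        p.cont.comp (continuous_pi fun i => (x i).continuous)⟩
      map_update_add' := by
        intro _ x i a b
        ext t
        have h : ∀ a : C(K, E), (fun j => (Function.update x i a j) t)
            = Function.update (fun j => x j t) i (a t) := by
          intro a; ext j; by_cases hj : j = i
          · subst hj; simp
          · simp [hj]
        simp only [ContinuousMap.coe_mk, ContinuousMap.add_apply]
        rw [h, h, h]
        simp
      map_update_smul' := by
        intro _ x i a b
        ext t
        have h : ∀ a : C(K, E), (fun j => (Function.update x i a j) t)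
            = Function.update (fun j => x j t) i (a t) := by
          intro a; ext j; by_cases hj : j = i
          · subst hj; simp
          · simp [hj]
        simp only [ContinuousMap.coe_mk, ContinuousMap.smul_apply]
        rw [h, h]
        simp }
    ‖p‖ (by
      intro x
      rw [ContinuousMap.norm_le _ (by positivity)]
      intro t
      refine (p.le_opNorm _).trans ?_
      gcongr with i
      exact (x i).norm_coe_le_norm t)

theorem liftMulti_apply {E K : Type*} [NormedAddCommGroup E] [NormedSpace ℂ E]
    [TopologicalSpace K] [CompactSpace K] {k : ℕ}
    (p : ContinuousMultilinearMap ℂ (fun _ : Fin k => E) ℂ) (x : Fin k → C(K, E)) (t : K) :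
    liftMulti p x t = p (fun i => x i t) := rfl

theorem liftMulti_norm {E K : Type*} [NormedAddCommGroup E] [NormedSpace ℂ E]
    [TopologicalSpace K] [CompactSpace K] {k : ℕ}
    (p : ContinuousMultilinearMap ℂ (fun _ : Fin k => E) ℂ) :
    ‖(liftMulti p : ContinuousMultilinearMap ℂ (fun _ : Fin k => C(K, E)) C(K, ℂ))‖ ≤ ‖p‖ :=
  MultilinearMap.mkContinuous_norm_le _ (norm_nonneg _) _

theorem lift_analytic {E : Type*} [NormedAddCommGroup E] [NormedSpace ℂ E] (K : Type*)
    [TopologicalSpace K] [CompactSpace K] {f : E → ℂ} {c : E} (hf : AnalyticAt ℂ f c) :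
    ∃ ρ > 0, ∃ Φ : C(K, E) → C(K, ℂ), AnalyticOnNhd ℂ Φ (Metric.ball 0 ρ) ∧
      ∀ x ∈ Metric.ball (0 : C(K, E)) ρ, ∀ t, Φ x t = f (c + x t) := by
  obtain ⟨p, R, hp⟩ := hf
  obtain ⟨ρ, hρ0, hρR⟩ := ENNReal.lt_iff_exists_nnreal_btwn.1 hp.r_pos
  have hρ0' : 0 < ρ := by exact_mod_cast hρ0
  let P : FormalMultilinearSeries ℂ C(K, E) C(K, ℂ) := fun k => liftMulti (p k)
  have hPr : (ρ : ℝ≥0∞) ≤ P.radius := by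
    obtain ⟨C, -, hC⟩ := p.norm_mul_pow_le_of_lt_radius (hρR.trans_le hp.r_le)
    refine P.le_radius_of_bound C fun k => le_trans ?_ (hC k)
    gcongr
    exact liftMulti_norm _
  have hPpos : 0 < P.radius := hρ0.trans_le hPr
  have hP := P.hasFPowerSeriesOnBall hPpos
  have hball : Metric.ball (0 : C(K, E)) ρ ⊆ Metric.eball 0 P.radius := by
    rw [← Metric.eball_coe]
    exact Metric.eball_subset_eball hPr
  refine ⟨ρ, by exact_mod_cast hρ0', P.sum, ?_, ?_⟩
  · exact fun x hx => hP.analyticOnNhd x (hball hx)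
  · intro x hx t
    have h1 := hP.hasSum (hball hx)
    have h2 := (ContinuousMap.evalCLM ℂ t).hasSum h1
    have h3 : x t ∈ Metric.eball (0 : E) R := by
      have : ‖x t‖ < ρ := (x.norm_coe_le_norm t).trans_lt (by simpa using hx)
      refine Metric.eball_subset_eball hρR.le ?_
      rw [Metric.eball_coe]; simpa using this
    have h4 := hp.hasSum h3
    rw [zero_add] at h2
    exact h2.unique h4

/-- averaging over the parameter interval -/
noncomputable def avgL : C(Set.Icc (0 : ℝ) (2 * Real.pi), ℂ) →L[ℂ] ℂ :=
  LinearMap.mkContinuous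
    { toFun := fun y => ∫ θ in (0 : ℝ)..(2 * Real.pi), y (Set.projIcc 0 (2 * Real.pi) (by positivity) θ)
      map_add' := by
        intro x y
        simp only [ContinuousMap.add_apply]
        apply intervalIntegral.integral_add
        · exact (x.continuous.comp continuous_projIcc).intervalIntegrable _ _
        · exact (y.continuous.comp continuous_projIcc).intervalIntegrable _ _
      map_smul' := by
        intro a y
        simp only [ContinuousMap.smul_apply, RingHom.id_apply]
        exact intervalIntegral.integral_smul _ _ }
    (2 * Real.pi) (by
      intro y
      have := intervalIntegral.norm_integral_le_of_norm_le_const (a := 0) (b := 2 * Real.pi)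
        (f := fun θ => y (Set.projIcc 0 (2 * Real.pi) (by positivity) θ)) (C := ‖y‖)
        (fun θ _ => y.norm_coe_le_norm _)
      rw [sub_zero, abs_of_pos (by positivity)] at this
      exact this.trans_eq (mul_comm _ _))

theorem avgL_apply (y : C(Set.Icc (0 : ℝ) (2 * Real.pi), ℂ)) (g : ℝ → ℂ)
    (h : ∀ θ, y θ = g θ) : avgL y = ∫ θ in (0 : ℝ)..(2 * Real.pi), g θ := by
  change (∫ θ in (0 : ℝ)..(2 * Real.pi), y (Set.projIcc 0 (2 * Real.pi) (by positivity) θ)) = _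
  apply intervalIntegral.integral_congr
  intro θ hθ
  rw [Set.uIcc_of_le (by positivity)] at hθ
  simp only
  rw [h, Set.projIcc_of_mem _ hθ]

theorem avg_analytic {E : Type*} [NormedAddCommGroup E] [NormedSpace ℂ E]
    {A B : E → ℂ} {c : E} (hA : AnalyticAt ℂ A c) (hB : AnalyticAt ℂ B c) (d : E) :
    ∃ ρ > 0, ∀ r : ℝ, 0 < r → r < ρ → (∀ t : ℂ, ‖t‖ = r → B (c + t • d) ≠ 0) →
      AnalyticAt ℂ (fun w => Real.circleAverage (fun t => A (w + t • d) / B (w + t • d)) 0 r) c := by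
  obtain ⟨ρ1, h1, Φ, hΦ, hΦA⟩ := lift_analytic (Set.Icc (0 : ℝ) (2 * Real.pi)) hA
  obtain ⟨ρ2, h2, Ψ, hΨ, hΨB⟩ := lift_analytic (Set.Icc (0 : ℝ) (2 * Real.pi)) hB
  refine ⟨min ρ1 ρ2 / (‖d‖ + 1), by positivity, ?_⟩
  intro r hr hrρ hne
  rw [lt_div_iff₀ (by positivity)] at hrρ
  let x0 : C(Set.Icc (0 : ℝ) (2 * Real.pi), E) :=
    ⟨fun θ => circleMap 0 r θ • d, by fun_prop⟩
  have hx0 : ‖x0‖ < min ρ1 ρ2 := by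
    refine lt_of_le_of_lt ?_ hrρ
    rw [ContinuousMap.norm_le _ (by positivity)]
    intro θ
    simp only [x0, ContinuousMap.coe_mk, norm_smul, norm_circleMap_zero, abs_of_pos hr]
    nlinarith
  let J : E →L[ℂ] C(Set.Icc (0 : ℝ) (2 * Real.pi), E) := LinearMap.mkContinuous
    { toFun := fun w => ContinuousMap.const _ w
      map_add' := fun _ _ => rfl
      map_smul' := fun _ _ => rfl } 1 (by
        intro w
        rw [one_mul, ContinuousMap.norm_le _ (by positivity)]
        intro θ; exact le_rfl)
  let j : E → C(Set.Icc (0 : ℝ) (2 * Real.pi), E) := fun w => J (w - c) + x0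
  have hjc : j c = x0 := by simp [j]
  have hj : AnalyticAt ℂ j c :=
    ((J.analyticAt _).comp (analyticAt_id.sub analyticAt_const)).add analyticAt_const
  have hjap : ∀ w θ, j w θ = (w - c) + circleMap 0 r θ • d := fun w θ => rfl
  have hΦj : AnalyticAt ℂ (fun w => Φ (j w)) c :=
    AnalyticAt.comp (hjc ▸ hΦ x0 (by simpa using hx0.trans_le (min_le_left _ _))) hj
  have hΨj : AnalyticAt ℂ (fun w => Ψ (j w)) c :=
    AnalyticAt.comp (hjc ▸ hΨ x0 (by simpa using hx0.trans_le (min_le_right _ _))) hj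
  have hnear : ∀ᶠ w in 𝓝 c, j w ∈ Metric.ball 0 (min ρ1 ρ2) :=
    hj.continuousAt.eventually_mem (Metric.isOpen_ball.mem_nhds (by rw [hjc]; simpa using hx0))
  have hunit0 : IsUnit (Ψ (j c)) := by
    rw [ContinuousMap.isUnit_iff_forall_ne_zero]
    intro θ
    rw [hΨB _ (by rw [hjc]; simpa using hx0.trans_le (min_le_right _ _)), hjap]
    simpa using hne (circleMap 0 r θ) (by simp [abs_of_pos hr])
  have hunit : ∀ᶠ w in 𝓝 c, IsUnit (Ψ (j w)) :=
    hΨj.continuousAt.eventually_mem (Units.isOpen.mem_nhds hunit0)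
  have hinv : AnalyticAt ℂ (fun w => Ring.inverse (Ψ (j w))) c := by
    have h := analyticAt_inverse (𝕜 := ℂ) hunit0.unit
    exact AnalyticAt.comp (g := Ring.inverse) (f := fun w => Ψ (j w)) h hΨj
  have hfin : AnalyticAt ℂ
      (fun w => ((2 * Real.pi)⁻¹ : ℝ) • avgL (Φ (j w) * Ring.inverse (Ψ (j w)))) c := by
    have h5 : AnalyticAt ℂ (fun w => avgL (Φ (j w) * Ring.inverse (Ψ (j w)))) c :=
      (avgL.analyticAt _).comp (hΦj.mul hinv)
    have h6 : AnalyticAt ℂ (fun w => (((2 * Real.pi)⁻¹ : ℝ) : ℂ) *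
      avgL (Φ (j w) * Ring.inverse (Ψ (j w)))) c := analyticAt_const.mul h5
    simpa only [Complex.real_smul] using h6
  refine hfin.congr ?_
  filter_upwards [hnear, hunit] with w hw hu
  rw [Real.circleAverage]
  congr 1
  apply avgL_apply
  intro θ
  have hval : Ring.inverse (Ψ (j w)) θ = (Ψ (j w) θ)⁻¹ := by
    have := Ring.mul_inverse_cancel _ hu
    have h7 := congrArg (fun f : C(Set.Icc (0 : ℝ) (2 * Real.pi), ℂ) => f θ) this
    simp only [ContinuousMap.mul_apply, ContinuousMap.one_apply] at h7
    exact eq_inv_of_mul_eq_one_right h7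
  rw [ContinuousMap.mul_apply, hval,
    hΦA _ (Metric.ball_subset_ball (min_le_left _ _) hw),
    hΨB _ (Metric.ball_subset_ball (min_le_right _ _) hw), hjap, div_eq_mul_inv]
  rw [show c + (w - c + circleMap 0 r ↑θ • d) = w + circleMap 0 r ↑θ • d by abel]

theorem eq_of_freq {X Y : Type*} [TopologicalSpace X] [TopologicalSpace Y] [T2Space Y]
    {f g : X → Y} {a : X} (hf : ContinuousAt f a) (hg : ContinuousAt g a)
    (h : ∃ᶠ x in 𝓝 a, f x = g x) : f a = g a := by
  by_contra hcon
  have hev : ∀ᶠ x in 𝓝 a, (f x, g x) ∈ (Set.diagonal Y)ᶜ :=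
    (hf.prodMk hg).eventually_mem (isClosed_diagonal.isOpen_compl.mem_nhds hcon)
  exact h (hev.mono fun x hx hx' => hx hx')

theorem exists_proj (N : ℕ) (d : Fin (N + 1) → ℂ) :
    ∃ π : (Fin (N + 1) → ℂ) →L[ℂ] (Fin N → ℂ), Function.Surjective π ∧ π d = 0 := by
  let S := Submodule.span ℂ {d}
  have h1 := Submodule.finrank_quotient_add_finrank S
  have h2 : Module.finrank ℂ S ≤ 1 := finrank_span_le_card (R := ℂ) ({d} : Set (Fin (N + 1) → ℂ)) |>.trans (by simp)
  have h3 : N ≤ Module.finrank ℂ ((Fin (N + 1) → ℂ) ⧸ S) := by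
    simp at h1; omega
  let e := (Module.finBasis ℂ ((Fin (N + 1) → ℂ) ⧸ S)).equivFun
  let g := LinearMap.funLeft ℂ ℂ (Fin.castLE h3)
  have hg : Function.Surjective g :=
    LinearMap.funLeft_surjective_of_injective ℂ ℂ _ (Fin.castLE_injective h3)
  refine ⟨LinearMap.toContinuousLinearMap (g ∘ₗ e.toLinearMap ∘ₗ S.mkQ), ?_, ?_⟩
  · have := hg.comp (e.surjective.comp S.mkQ_surjective)
    exact this
  · have : S.mkQ d = 0 := by
      simp [S]
    simp [this]

theorem finrank_real_pi (N : ℕ) : Module.finrank ℝ (Fin N → ℂ) = 2 * N := by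
  rw [Module.finrank_pi_fintype]
  simp [mul_comm]

theorem dense_lines {N : ℕ} {S : Set (Fin (N + 1) → ℂ)} (hS : dimH S < ((2 * N : ℕ) : ℝ≥0∞))
    (d : Fin (N + 1) → ℂ) : Dense {w : Fin (N + 1) → ℂ | ∀ t : ℂ, w + t • d ∉ S} := by
  obtain ⟨π, hπ, hd⟩ := exists_proj N d
  have h1 : dimH (π '' S) < Module.finrank ℝ (Fin N → ℂ) := by
    rw [finrank_real_pi]
    exact (π.lipschitz.dimH_image_le S).trans_lt hS
  have h2 := dense_compl_of_dimH_lt_finrank h1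
  have h3 := h2.preimage (π.isOpenMap hπ)
  refine h3.mono ?_
  intro w hw t ht
  apply hw
  exact ⟨_, ht, by simp [hd]⟩

theorem ext_lemma {N : ℕ} {ι : Type*} {c : Fin (N + 1) → ℂ} {W : Set (Fin (N + 1) → ℂ)}
    (hW : W ∈ 𝓝 c) {A B : ι → (Fin (N + 1) → ℂ) → ℂ}
    (hA : ∀ i, AnalyticOnNhd ℂ (A i) W) (hB : ∀ i, AnalyticOnNhd ℂ (B i) W)
    (hrel : ∀ z ∈ W, ∀ i j, A i z * B j z = A j z * B i z)
    (hdim : dimH {z ∈ W | ∀ i, B i z = 0} < ((2 * N : ℕ) : ℝ≥0∞)) :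
    ∃ h : (Fin (N + 1) → ℂ) → ℂ, AnalyticAt ℂ h c ∧ ∀ᶠ z in 𝓝 c, ∀ i, A i z = h z * B i z := by
  obtain ⟨ε, hε, hball⟩ := Metric.mem_nhds_iff.1 hW
  set S := {z ∈ W | ∀ i, B i z = 0} with hSdef
  -- a point where some B is nonzero
  have hdense := dense_lines hdim
  obtain ⟨p, hpball, hp⟩ := (hdense 0).exists_mem_open (Metric.isOpen_ball (x := c) (ε := ε))
    ⟨c, Metric.mem_ball_self hε⟩
  have hpS : p ∉ S := by simpa using hpball
  obtain ⟨i0, hi0⟩ : ∃ i, B i p ≠ 0 := by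
    by_contra hcon
    push Not at hcon
    exact hpS ⟨hball hp, hcon⟩
  set d := p - c with hd
  -- restriction to the line
  let ℓ : ℂ → (Fin (N + 1) → ℂ) := fun t => c + t • d
  have hℓan : ∀ t, AnalyticAt ℂ ℓ t := fun t =>
    analyticAt_const.add (analyticAt_id.smul analyticAt_const)
  have hpre : IsPreconnected (ℓ ⁻¹' Metric.ball c ε) := by
    apply Convex.isPreconnected
    have : Convex ℝ (Metric.ball c ε) := convex_ball c ε
    intro x hx y hy a b ha hb hab
    have h := this hx hy ha hb hab
    have : ℓ (a • x + b • y) = a • ℓ x + b • ℓ y := by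
      simp only [ℓ, smul_add, add_smul]
      have hc : c = a • c + b • c := by rw [← add_smul, hab, one_smul]
      conv_lhs => rw [hc]
      simp only [smul_assoc]
      abel
    rw [mem_preimage, this]; exact h
  have hgan : AnalyticOnNhd ℂ (fun t => B i0 (ℓ t)) (ℓ ⁻¹' Metric.ball c ε) := fun t ht =>
    AnalyticAt.comp (hB i0 _ (hball ht)) (hℓan t)
  have h0mem : (0 : ℂ) ∈ ℓ ⁻¹' Metric.ball c ε := by simp [ℓ, hε]
  have h1mem : (1 : ℂ) ∈ ℓ ⁻¹' Metric.ball c ε := by simpa [ℓ, hd] using hp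
  have hne : ∀ᶠ t in 𝓝[≠] (0 : ℂ), B i0 (ℓ t) ≠ 0 := by
    rcases (hgan 0 h0mem).eventually_eq_zero_or_eventually_ne_zero with h | h
    · exfalso
      have := hgan.eqOn_zero_of_preconnected_of_eventuallyEq_zero hpre h0mem h h1mem
      apply hi0
      simpa [ℓ, hd] using this
    · exact h
  obtain ⟨ρ, hρ, havg⟩ := avg_analytic (hA i0 c (hball (Metric.mem_ball_self hε)))
    (hB i0 c (hball (Metric.mem_ball_self hε))) d
  rw [eventually_nhdsWithin_iff, Metric.eventually_nhds_iff] at hne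
  obtain ⟨ρ', hρ', hne⟩ := hne
  -- choose the radius
  obtain ⟨r, hr0, hr⟩ : ∃ r : ℝ, 0 < r ∧ r < min (min ρ ρ') (ε / (2 * (‖d‖ + 1))) :=
    exists_between (by positivity)
  have hrρ : r < ρ := hr.trans_le ((min_le_left _ _).trans (min_le_left _ _))
  have hrρ' : r < ρ' := hr.trans_le ((min_le_left _ _).trans (min_le_right _ _))
  have hrε : r * (‖d‖ + 1) < ε / 2 := by
    have := hr.trans_le (min_le_right _ _)
    rw [lt_div_iff₀ (by positivity)] at this
    linarith
  have hcirc : ∀ t : ℂ, ‖t‖ = r → B i0 (c + t • d) ≠ 0 := fun t ht =>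
    hne (by simpa [ht] using hrρ') (by rintro rfl; simp at ht; linarith)
  have hF := havg r hr0 hrρ hcirc
  set F := fun w => Real.circleAverage (fun t => A i0 (w + t • d) / B i0 (w + t • d)) 0 r with hFdef
  -- points near c
  have hin : ∀ w ∈ Metric.ball c (ε / 2), ∀ t : ℂ, ‖t‖ ≤ r → w + t • d ∈ W := by
    intro w hw t ht
    apply hball
    rw [mem_ball_iff_norm] at hw ⊢
    have h1 : ‖t • d‖ ≤ r * (‖d‖ + 1) := by
      rw [norm_smul]
      have := norm_nonneg d
      nlinarith
    calc ‖w + t • d - c‖ = ‖(w - c) + t • d‖ := by congr 1; abel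
      _ ≤ ‖w - c‖ + ‖t • d‖ := norm_add_le _ _
      _ < ε := by linarith
  -- nonvanishing on the circle for w near c
  have hcirc' : ∀ᶠ w in 𝓝 c, ∀ t ∈ Metric.sphere (0 : ℂ) r, B i0 (w + t • d) ≠ 0 := by
    apply (isCompact_sphere (0 : ℂ) r).eventually_forall_of_forall_eventually
    intro t ht
    have ht' : ‖t‖ = r := by simpa using ht
    have hcont : ContinuousAt (fun z : (Fin (N + 1) → ℂ) × ℂ => B i0 (z.1 + z.2 • d)) (c, t) := by
      have h1 : ContinuousAt (B i0) (c + t • d) :=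
        (hB i0 _ (hin c (by simpa using half_pos hε) t ht'.le)).continuousAt
      have h2 : ContinuousAt (fun z : (Fin (N + 1) → ℂ) × ℂ => z.1 + z.2 • d) (c, t) := by fun_prop
      exact ContinuousAt.comp (g := B i0) h1 h2
    exact hcont.eventually_ne (hcirc t ht')
  -- key identity on a dense set
  have hkey : ∀ w ∈ Metric.ball c (ε / 2), (∀ t ∈ Metric.sphere (0 : ℂ) r, B i0 (w + t • d) ≠ 0) →
      (∀ t : ℂ, w + t • d ∉ S) → ∀ i, A i w = F w * B i w := by
    intro w hw hwc hwS
    have hex : ∀ t : ℂ, ‖t‖ ≤ r → ∃ i, B i (w + t • d) ≠ 0 := by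
      intro t ht
      by_contra hcon
      push Not at hcon
      exact hwS t ⟨hin w hw t ht, hcon⟩
    have : Nonempty ι := ⟨i0⟩
    choose! s hs using hex
    let φ : ℂ → ℂ := fun t => A (s t) (w + t • d) / B (s t) (w + t • d)
    have hφ : ∀ t : ℂ, ‖t‖ ≤ r → ∀ i, B i (w + t • d) ≠ 0 →
        φ t = A i (w + t • d) / B i (w + t • d) := by
      intro t ht i hi
      simp only [φ]
      rw [div_eq_div_iff (hs t ht) hi]
      exact hrel _ (hin w hw t ht) _ _
    have hline : ∀ t, AnalyticAt ℂ (fun t : ℂ => w + t • d) t := fun t =>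
      analyticAt_const.add (analyticAt_id.smul analyticAt_const)
    have hquot : ∀ t : ℂ, ‖t‖ ≤ r → DifferentiableAt ℂ
        (fun t' => A (s t) (w + t' • d) / B (s t) (w + t' • d)) t := by
      intro t ht
      have hW' := hin w hw t ht
      have h1 : AnalyticAt ℂ (fun t' : ℂ => A (s t) (w + t' • d)) t :=
        AnalyticAt.comp (hA _ _ hW') (hline t)
      have h2 : AnalyticAt ℂ (fun t' : ℂ => B (s t) (w + t' • d)) t :=
        AnalyticAt.comp (hB _ _ hW') (hline t)
      exact (h1.div h2 (hs t ht)).differentiableAt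
    have hevne : ∀ t : ℂ, ‖t‖ ≤ r → ∀ᶠ t' in 𝓝 t, B (s t) (w + t' • d) ≠ 0 := by
      intro t ht
      have h2 : AnalyticAt ℂ (fun t' : ℂ => B (s t) (w + t' • d)) t :=
        AnalyticAt.comp (hB _ _ (hin w hw t ht)) (hline t)
      exact h2.continuousAt.eventually_ne (hs t ht)
    have hcontφ : ContinuousOn φ (Metric.closedBall 0 |r|) := by
      intro t ht
      have ht' : ‖t‖ ≤ r := by simpa [abs_of_pos hr0] using ht
      refine (hquot t ht').continuousAt.continuousWithinAt.congr_of_eventuallyEq_of_mem ?_ ht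
      filter_upwards [mem_nhdsWithin_of_mem_nhds (hevne t ht'), self_mem_nhdsWithin] with t' h1 h2
      exact hφ t' (by simpa [abs_of_pos hr0] using h2) _ h1
    have hdiffφ : ∀ t ∈ Metric.ball (0 : ℂ) |r| \ ∅, DifferentiableAt ℂ φ t := by
      intro t ht
      have ht' : ‖t‖ < r := by simpa [abs_of_pos hr0] using ht
      refine (hquot t ht'.le).congr_of_eventuallyEq ?_
      have hb : ∀ᶠ t' in 𝓝 t, t' ∈ Metric.ball (0 : ℂ) r :=
        Metric.isOpen_ball.mem_nhds (by simpa using ht')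
      filter_upwards [hevne t ht'.le, hb] with t' h1 h2
      exact hφ t' (by simpa using (mem_ball_zero_iff.1 h2).le) _ h1
    have hav := circleAverage_of_differentiable_on_off_countable countable_empty hcontφ hdiffφ
    have hFφ : F w = φ 0 := by
      rw [← hav]
      apply Real.circleAverage_congr_sphere
      intro t ht
      rw [abs_of_pos hr0] at ht
      have ht' : ‖t‖ = r := by simpa using ht
      exact (hφ t ht'.le i0 (hwc t ht)).symm
    intro i
    have hs0 := hs 0 (by simpa using hr0.le)
    have hw0 := hin w hw 0 (by simpa using hr0.le)
    rw [hFφ]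
    simp only [φ]
    simp only [zero_smul, add_zero] at hs0 hw0 ⊢
    rw [div_mul_eq_mul_div, eq_div_iff hs0]
    exact hrel w hw0 _ _
  refine ⟨F, hF, ?_⟩
  have hFc : ∀ᶠ w in 𝓝 c, ContinuousAt F w := hF.eventually_continuousAt
  have hbb : ∀ᶠ w in 𝓝 c, w ∈ Metric.ball c (ε / 2) := Metric.ball_mem_nhds _ (half_pos hε)
  have hall := (hFc.and (hbb.and hcirc')).eventually_nhds
  filter_upwards [hall] with w hw i
  have hwself := hw.self_of_nhds
  -- density
  have hfreq : ∃ᶠ w' in 𝓝 w, A i w' = F w' * B i w' := by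
    have h1 : ∃ᶠ w' in 𝓝 w, w' ∈ {w : Fin (N + 1) → ℂ | ∀ t : ℂ, w + t • d ∉ S} :=
      mem_closure_iff_frequently.1 (hdense d w)
    refine (h1.and_eventually hw).mono ?_
    rintro w' ⟨h2, -, h3, h4⟩
    exact hkey w' h3 h4 h2 i
  have hwW : w ∈ W := by simpa using hin w hwself.2.1 0 (by simpa using hr0.le)
  exact eq_of_freq (hA i w hwW).continuousAt (hwself.1.mul (hB i w hwW).continuousAt) hfreq

theorem append_update_l {α : Type*} {k m : ℕ} (x : Fin k → α) (w : Fin m → α) (i : Fin k) (u : α) :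
    Fin.append (Function.update x i u) w = Function.update (Fin.append x w) (Fin.castAdd m i) u := by
  ext j
  refine Fin.addCases (fun a => ?_) (fun b => ?_) j
  · by_cases h : a = i
    · subst h; simp
    · have : Fin.castAdd m a ≠ Fin.castAdd m i := fun h' => h (Fin.castAdd_injective k m h')
      simp [h, this]
  · have : Fin.natAdd k b ≠ Fin.castAdd m i := fun h' => by
      have := congrArg Fin.val h'
      simp at this; omega
    simp [this]

theorem append_update_r {α : Type*} {k m : ℕ} (x : Fin k → α) (w : Fin m → α) (i : Fin m) (u : α) :
    Fin.append x (Function.update w i u) = Function.update (Fin.append x w) (Fin.natAdd k i) u := by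
  ext j
  refine Fin.addCases (fun a => ?_) (fun b => ?_) j
  · have : Fin.castAdd m a ≠ Fin.natAdd k i := fun h' => by
      have := congrArg Fin.val h'
      simp at this; omega
    simp [this]
  · by_cases h : b = i
    · subst h; simp
    · have : Fin.natAdd k b ≠ Fin.natAdd k i := fun h' => h (Fin.natAdd_injective m k h')
      simp [h, this]

/-- contraction of a top form with `k` vectors -/
def contr {k m : ℕ} {V : Type*} [AddCommGroup V] [Module ℂ V]
    (Θ : AlternatingMap ℂ V ℂ (Fin (k + m))) (x : Fin k → V) : AlternatingMap ℂ V ℂ (Fin m) where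
  toFun w := Θ (Fin.append x w)
  map_update_add' := by
    intro inst w i a b
    rw [Subsingleton.elim inst (instDecidableEqFin m)]
    simp only [append_update_r]
    simp
  map_update_smul' := by
    intro inst w i a b
    rw [Subsingleton.elim inst (instDecidableEqFin m)]
    simp only [append_update_r]
    simp
  map_eq_zero_of_eq' := by
    intro w i j h hij
    apply Θ.map_eq_zero_of_eq _ (i := Fin.natAdd k i) (j := Fin.natAdd k j) (by simpa using h)
    intro h'; exact hij (Fin.natAdd_injective m k h')

theorem contr_apply {k m : ℕ} {V : Type*} [AddCommGroup V] [Module ℂ V]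
    (Θ : AlternatingMap ℂ V ℂ (Fin (k + m))) (x : Fin k → V) (w : Fin m → V) :
    contr Θ x w = Θ (Fin.append x w) := rfl

/-- `α` is killed by the vector `x`. -/
def Kills {m : ℕ} {V : Type*} [AddCommGroup V] [Module ℂ V]
    (α : AlternatingMap ℂ V ℂ (Fin m)) (x : V) : Prop :=
  ∀ (w : Fin m → V) (j : Fin m), w j = x → α w = 0

theorem contr_kills {k m : ℕ} {V : Type*} [AddCommGroup V] [Module ℂ V]
    (Θ : AlternatingMap ℂ V ℂ (Fin (k + m))) (x : Fin k → V) (i : Fin k) :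
    Kills (contr Θ x) (x i) := by
  intro w j h
  rw [contr_apply]
  apply Θ.map_eq_zero_of_eq _ (i := Fin.castAdd m i) (j := Fin.natAdd k j) (by simpa using h.symm)
  intro h'
  have := congrArg Fin.val h'
  simp at this; omega

theorem prop_of_kills {k m : ℕ} {V : Type*} [AddCommGroup V] [Module ℂ V]
    (α β : AlternatingMap ℂ V ℂ (Fin m)) (x : Fin k → V) (v : Fin m → V)
    (b : Module.Basis (Fin (k + m)) ℂ V) (hb : ⇑b = Fin.append x v)
    (hα : ∀ i, Kills α (x i)) (hβ : ∀ i, Kills β (x i)) (w : Fin m → V) :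
    α w * β v = α v * β w := by
  have : β v • α = α v • β := by
    apply b.ext_alternating
    intro s hs
    simp only [AlternatingMap.smul_apply, smul_eq_mul, hb]
    by_cases h : ∃ j i, s j = Fin.castAdd m i
    · obtain ⟨j, i, h⟩ := h
      have h3 : Fin.append x v (s j) = x i := by rw [h, Fin.append_left]
      rw [hα i (fun j => Fin.append x v (s j)) j h3, hβ i (fun j => Fin.append x v (s j)) j h3,
        mul_zero, mul_zero]
    · push Not at h
      have h2 : ∀ j, ∃ l, s j = Fin.natAdd k l := by
        intro j
        have := h j
        revert this
        refine Fin.addCases (fun a => ?_) (fun b => ?_) (s j)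
        · intro h'; exact absurd rfl (h' a)
        · intro _; exact ⟨b, rfl⟩
      choose σ hσ using h2
      have hinj : Function.Injective σ := by
        intro a b hab
        apply hs
        rw [hσ, hσ, hab]
      let τ : Equiv.Perm (Fin m) := Equiv.ofBijective σ (Finite.injective_iff_bijective.1 hinj)
      have hv : (fun i => Fin.append x v (s i)) = v ∘ τ := by
        ext i; simp [hσ, τ]
      rw [hv, α.map_perm, β.map_perm]
      simp only [Units.smul_def, zsmul_eq_mul]
      ring
  have h2 := congrArg (fun f : AlternatingMap ℂ V ℂ (Fin m) => f w) this
  simp only [AlternatingMap.smul_apply, smul_eq_mul] at h2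
  linear_combination h2

theorem kills_coeff {k m : ℕ} {V : Type*} [AddCommGroup V] [Module ℂ V]
    (α : AlternatingMap ℂ V ℂ (Fin m)) (x : Fin k → V) (v : Fin m → V)
    (hα : ∀ i, Kills α (x i)) (a : Fin k → ℂ) (b : Fin m → ℂ) (j : Fin m) :
    α (Function.update v j (∑ i, a i • x i + ∑ l, b l • v l)) = b j * α v := by
  rw [AlternatingMap.map_update_add, AlternatingMap.map_update_sum, AlternatingMap.map_update_sum]
  rw [Finset.sum_eq_zero, Finset.sum_eq_single j]
  · simp
  · intro l _ hl
    rw [AlternatingMap.map_update_smul, AlternatingMap.map_update_self _ _ hl.symm, smul_zero]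
  · simp
  · intro i _
    rw [AlternatingMap.map_update_smul, hα i _ j (by simp), smul_zero]

theorem basis_of_ne {k m : ℕ} (Θ : AlternatingMap ℂ (Cn (k + m)) ℂ (Fin (k + m)))
    (x : Fin (k + m) → Cn (k + m)) (h : Θ x ≠ 0) :
    ∃ b : Module.Basis (Fin (k + m)) ℂ (Cn (k + m)), ⇑b = x := by
  have hli : LinearIndependent ℂ x := by
    by_contra hcon
    exact h (Θ.map_linearDependent _ hcon)
  exact ⟨basisOfLinearIndependentOfCardEqFinrank' x hli (by simp), by simp⟩

/-- pointwise statement for the direction (b) to (a) -/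
theorem pointwise {k m : ℕ} (Θ : AlternatingMap ℂ (Cn (k + m)) ℂ (Fin (k + m)))
    (x : Fin k → Cn (k + m)) (u : Cn (k + m)) (hne : contr Θ x ≠ 0) (hu : Kills (contr Θ x) u) :
    ∃ a : Fin k → ℂ, u = ∑ i, a i • x i ∧
      ∀ i w, Θ (Fin.append (Function.update x i u) w) = a i * Θ (Fin.append x w) := by
  obtain ⟨v, hv⟩ : ∃ v, contr Θ x v ≠ 0 := by
    by_contra hcon
    push Not at hcon
    exact hne (by ext v; simpa using hcon v)
  obtain ⟨b, hb⟩ := basis_of_ne Θ _ hv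
  have hsum := b.sum_repr u
  rw [Fin.sum_univ_add] at hsum
  simp only [hb, Fin.append_left, Fin.append_right] at hsum
  have hb0 : ∀ j, b.repr u (Fin.natAdd k j) = 0 := by
    intro j
    have h1 := kills_coeff (contr Θ x) x v (contr_kills Θ x)
      (fun i => b.repr u (Fin.castAdd m i)) (fun j => b.repr u (Fin.natAdd k j)) j
    rw [hsum, hu _ j (by simp)] at h1
    rcases mul_eq_zero.1 h1.symm with h | h
    · exact h
    · exact absurd h hv
  have hu' : u = ∑ i, b.repr u (Fin.castAdd m i) • x i := by
    conv_lhs => rw [← hsum]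
    simp [hb0]
  refine ⟨fun i => b.repr u (Fin.castAdd m i), hu', ?_⟩
  intro i w
  rw [append_update_l]
  conv_lhs => rw [hu']
  rw [AlternatingMap.map_update_sum, Finset.sum_eq_single i]
  · rw [AlternatingMap.map_update_smul]
    congr 2
    rw [← append_update_l, Function.update_eq_self]
  · intro l _ hl
    rw [AlternatingMap.map_update_smul]
    have := AlternatingMap.map_update_self Θ (Fin.append x w) (i := Fin.castAdd m i)
      (j := Fin.castAdd m l) (fun h => hl (Fin.castAdd_injective k m h).symm)
    rw [Fin.append_left] at this
    rw [this, smul_zero]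
  · simp

theorem top_analytic {n : ℕ} {Θ : Form n n} {Y : Fin n → VF n} {c : Cn n}
    (hΘ : HolFormAt c Θ) (hY : ∀ i, AnalyticAt ℂ (Y i) c) :
    AnalyticAt ℂ (fun z => Θ z (fun i => Y i z)) c := by
  let e := Pi.basisFun ℂ (Fin n)
  have h1 : ∀ z, Θ z (fun i => Y i z) = Θ z e * (Matrix.of fun i j => Y j z i).det := by
    intro z
    conv_lhs => rw [(Θ z).eq_smul_basis_det e]
    simp only [AlternatingMap.smul_apply, smul_eq_mul, Module.Basis.det_apply]
    congr 2
  simp_rw [h1, Matrix.det_apply]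
  refine (hΘ e).mul (Finset.analyticAt_fun_sum _ fun σ _ => ?_)
  simp only [Units.smul_def, zsmul_eq_mul]
  refine analyticAt_const.mul (Finset.analyticAt_fun_prod _ fun i _ => ?_)
  exact analyticAt_pi_iff.1 (hY i) (σ i)

theorem codim_lt {n : ℕ} (hn : 2 ≤ n) {V : Set (Cn n)} (h : CodimGE n V 2) :
    dimH V < ((2 * (n - 1) : ℕ) : ℝ≥0∞) := by
  rcases h with h | h
  · rw [h, dimH_empty]
    have : 0 < 2 * (n - 1) := by omega
    exact_mod_cast this
  · by_contra hcon
    push Not at hcon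
    have h1 : ((2 * (n - 1) : ℕ) : ℝ≥0∞) + 2 * ((2 : ℕ) : ℝ≥0∞) ≤ 2 * (n : ℝ≥0∞) :=
      (add_le_add_left hcon _).trans h
    have h2 : 2 * (n - 1) + 2 * 2 ≤ 2 * n := by exact_mod_cast h1
    omega

theorem ext_codim {n : ℕ} (hn : 2 ≤ n) {ι : Type*} {c : Cn n} {W V : Set (Cn n)}
    (hW : W ∈ 𝓝 c) {A B : ι → Cn n → ℂ}
    (hA : ∀ i, AnalyticOnNhd ℂ (A i) W) (hB : ∀ i, AnalyticOnNhd ℂ (B i) W)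
    (hrel : ∀ z ∈ W, ∀ i j, A i z * B j z = A j z * B i z)
    (hV : CodimGE n V 2) (hsub : ∀ z ∈ W, (∀ i, B i z = 0) → z ∈ V) :
    ∃ h : Cn n → ℂ, AnalyticAt ℂ h c ∧ ∀ᶠ z in 𝓝 c, ∀ i, A i z = h z * B i z := by
  obtain ⟨N, rfl⟩ : ∃ N, n = N + 1 := ⟨n - 1, by omega⟩
  refine ext_lemma hW hA hB hrel (lt_of_le_of_lt (dimH_mono ?_) (codim_lt hn hV))
  rintro z ⟨h1, h2⟩
  exact hsub z h1 h2

theorem freq_ne {n m : ℕ} (hn : 2 ≤ n) {U : Set (Cn n)} (hU : IsOpen U) {ω : Form n m}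
    (hcodim : CodimGE n {z ∈ U | ω z = 0} 2) {z : Cn n} (hz : z ∈ U) :
    ∃ᶠ z' in 𝓝 z, ω z' ≠ 0 := by
  have h1 : dimH {z ∈ U | ω z = 0} < Module.finrank ℝ (Cn n) := by
    rw [finrank_real_pi]
    refine (codim_lt hn hcodim).trans_le ?_
    have : 2 * (n - 1) ≤ 2 * n := by omega
    exact_mod_cast this
  have h2 := mem_closure_iff_frequently.1 (dense_compl_of_dimH_lt_finrank h1 z)
  refine (h2.and_eventually (hU.mem_nhds hz)).mono ?_
  rintro z' ⟨h3, h4⟩ h5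
  exact h3 ⟨h4, h5⟩

theorem polydisc_open {n : ℕ} {U : Set (Cn n)} (hU : IsPolydisc U) : IsOpen U := by
  obtain ⟨c, r, -, rfl⟩ := hU
  simp only [setOf_forall]
  refine isOpen_iInter_of_finite fun i => ?_
  exact isOpen_lt (by fun_prop) continuous_const

theorem append_analytic {k m : ℕ} {Y : Fin k → VF (k + m)} {c : Cn (k + m)}
    (hY : ∀ i, AnalyticAt ℂ (Y i) c) (w : Fin m → Cn (k + m)) (i : Fin (k + m)) :
    AnalyticAt ℂ (fun z => Fin.append (fun a => Y a z) w i) c := by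
  refine Fin.addCases (fun a => ?_) (fun b => ?_) i
  · simpa using hY a
  · simpa using analyticAt_const

theorem b_to_a {k m : ℕ} (hn : 2 ≤ k + m) {U : Set (Cn (k + m))} (hU : IsOpen U)
    {ω : Form (k + m) m} (hcodim : CodimGE (k + m) {z ∈ U | ω z = 0} 2)
    {Xs : Fin k → VF (k + m)} (hXs : ∀ i, AnalyticOnNhd ℂ (Xs i) U)
    {Θ : Form (k + m) (k + m)} (hΘ : HolFormOn U Θ)
    (hω : ∀ z ∈ U, ω z = contr (Θ z) (fun a => Xs a z)) :
    (∀ i, ∀ z ∈ U, TangentAt ω (Xs i) z) ∧ ∀ z ∈ U, FreeGensAt ω Xs z := by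
  refine ⟨?_, ?_⟩
  · intro i z hz v j hv
    rw [hω z hz]
    exact contr_kills (Θ z) (fun a => Xs a z) i v j hv
  intro c hc
  refine ⟨?_, ?_⟩
  · intro Z hZ hZt
    let W := {z | z ∈ U ∧ AnalyticAt ℂ Z z ∧ TangentAt ω Z z}
    have hUc : ∀ᶠ z in 𝓝 c, z ∈ U := hU.mem_nhds hc
    have hW : W ∈ 𝓝 c := hUc.and (hZ.eventually_analyticAt.and hZt)
    have hpt : ∀ z ∈ W, ω z ≠ 0 → ∃ a : Fin k → ℂ, Z z = ∑ i, a i • Xs i z ∧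
        ∀ i w, Θ z (Fin.append (Function.update (fun a => Xs a z) i (Z z)) w) = a i * ω z w := by
      rintro z ⟨hz, -, ht⟩ hne
      rw [hω z hz] at hne ⊢
      refine pointwise (Θ z) (fun a => Xs a z) (Z z) hne ?_
      rw [← hω z hz]
      exact ht
    have hωan : ∀ w, AnalyticOnNhd ℂ (fun z => ω z w) U := by
      intro w z hz
      have h1 : AnalyticAt ℂ (fun z => Θ z (Fin.append (fun a => Xs a z) w)) z :=
        top_analytic (Y := fun i z => Fin.append (fun a => Xs a z) w i)
          (fun v => hΘ v z hz) (append_analytic (fun i => hXs i z hz) w)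
      refine h1.congr ?_
      filter_upwards [hU.mem_nhds hz] with z' hz'
      rw [hω z' hz', contr_apply]
    have hext : ∀ i : Fin k, ∃ h : Cn (k + m) → ℂ, AnalyticAt ℂ h c ∧ ∀ᶠ z in 𝓝 c,
        ∀ w, Θ z (Fin.append (Function.update (fun a => Xs a z) i (Z z)) w) = h z * ω z w := by
      intro i
      refine ext_codim hn hW (A := fun w z =>
        Θ z (Fin.append (Function.update (fun a => Xs a z) i (Z z)) w))
        (B := fun w z => ω z w) ?_ ?_ ?_ hcodim ?_
      · intro w z hz
        have h2 : ∀ l, AnalyticAt ℂ ((Function.update Xs i Z) l) z := by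
          intro l
          by_cases h : l = i
          · subst h; simpa using hz.2.1
          · simpa [h] using hXs l z hz.1
        have h1 := top_analytic (Y := fun j z => Fin.append (fun a => (Function.update Xs i Z) a z) w j)
          (fun v => hΘ v z hz.1) (append_analytic h2 w)
        have h3 : ∀ z, (fun a => (Function.update Xs i Z) a z)
            = Function.update (fun a => Xs a z) i (Z z) := by
          intro z; ext1 a
          by_cases h : a = i
          · subst h; simp
          · simp [h]
        simp only [h3] at h1
        exact h1
      · exact fun w z hz => hωan w z hz.1
      · intro z hz w w'
        by_cases h0 : ω z = 0
        · simp [h0]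
        · obtain ⟨a, -, ha⟩ := hpt z hz h0
          simp only [ha]
          ring
      · intro z hz h
        exact ⟨hz.1, by ext w; simpa using h w⟩
    choose f hfan hf using hext
    refine ⟨f, hfan, ?_⟩
    have hcont : ∀ᶠ z in 𝓝 c, ∀ i, ContinuousAt (f i) z :=
      eventually_all.2 fun i => (hfan i).eventually_continuousAt
    have hev := (hcont.and ((eventually_all.2 hf).and hW)).eventually_nhds
    filter_upwards [hev] with z hz
    obtain ⟨hz1, -, hz3⟩ := hz.self_of_nhds
    refine eq_of_freq (f := Z) (g := fun z => ∑ i, f i z • Xs i z) hz3.2.1.continuousAt ?_ ?_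
    · exact tendsto_finset_sum _ fun i _ => (hz1 i).smul (hXs i z hz3.1).continuousAt
    · refine ((freq_ne hn hU hcodim hz3.1).and_eventually hz).mono ?_
      rintro z' ⟨hne, -, h2, h3⟩
      obtain ⟨a, ha1, ha2⟩ := hpt z' h3 hne
      obtain ⟨w, hw⟩ : ∃ w, ω z' w ≠ 0 := by
        by_contra hcon
        push Not at hcon
        exact hne (by ext w; simpa using hcon w)
      have : ∀ i, f i z' = a i := by
        intro i
        have h4 := (h2 i w).symm.trans (ha2 i w)
        exact mul_right_cancel₀ hw h4
      simp only [this]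
      exact ha1
  · intro f hf hsum i
    have hcont : ∀ᶠ z in 𝓝 c, ContinuousAt (f i) z := (hf i).eventually_continuousAt
    have hUc : ∀ᶠ z in 𝓝 c, z ∈ U := hU.mem_nhds hc
    have hev := (hcont.and (hsum.and hUc)).eventually_nhds
    filter_upwards [hev] with z hz
    obtain ⟨hz1, -, hz3⟩ := hz.self_of_nhds
    refine eq_of_freq (f := f i) (g := fun _ => 0) hz1 continuousAt_const ?_
    refine ((freq_ne hn hU hcodim hz3).and_eventually hz).mono ?_
    rintro z' ⟨hne, -, h2, h3⟩
    rw [hω z' h3] at hne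
    obtain ⟨v, hv⟩ : ∃ v, contr (Θ z') (fun a => Xs a z') v ≠ 0 := by
      by_contra hcon
      push Not at hcon
      exact hne (by ext w; simpa using hcon w)
    obtain ⟨b, hb⟩ := basis_of_ne (Θ z') _ hv
    have hli := b.linearIndependent.comp _ (Fin.castAdd_injective k m)
    have hb' : ⇑b ∘ Fin.castAdd m = fun a => Xs a z' := by
      ext1 a; simp [hb]
    rw [hb'] at hli
    exact Fintype.linearIndependent_iff.1 hli (fun i => f i z') h2 i

theorem spanning {k m : ℕ} {U : Set (Cn (k + m))}
    {ω : Form (k + m) m} (hol : HolFormOn U ω) (hdec : LocallyDecomp U ω)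
    {Xs : Fin k → VF (k + m)} (hfree : ∀ z ∈ U, FreeGensAt ω Xs z)
    {z : Cn (k + m)} (hz : z ∈ U) {v : Fin m → Cn (k + m)} (hv : ω z v ≠ 0) :
    LinearIndependent ℂ (Fin.append (fun a => Xs a z) v) := by
  obtain ⟨W, hW, hWU, η, -, hη⟩ := hdec z hz (fun h => hv (by simp [h]))
  apply linearIndependent_of_top_le_span_of_card_eq_finrank _ (by simp)
  intro u _
  let Y : VF (k + m) := fun y => ω y v • u - ∑ j, ω y (Function.update v j u) • v j
  have hYan : AnalyticAt ℂ Y z :=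
    ((hol v z hz).smul analyticAt_const).sub
      (Finset.analyticAt_fun_sum _ fun j _ => (hol _ z hz).smul analyticAt_const)
  have hYt : ∀ᶠ y in 𝓝 z, TangentAt ω Y y := by
    filter_upwards [hW] with y hy
    intro v' i hv'
    rw [hη y hy]
    apply Matrix.det_eq_zero_of_column_eq_zero i
    intro a
    simp only [Matrix.of_apply, hv']
    let M : Matrix (Fin m) (Fin m) ℂ := Matrix.of fun i j => η i y (v j)
    let bb : Fin m → ℂ := fun a => η a y u
    have hcr := congrFun (Matrix.mulVec_cramer M bb) a
    have hup : ∀ j, ω y (Function.update v j u) = M.cramer bb j := by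
      intro j
      rw [hη y hy, Matrix.cramer_apply]
      congr 1
      ext a l
      by_cases h : l = j
      · subst h; simp [bb]
      · simp [h, M]
    simp only [Y, map_sub, map_smul, map_sum, hup, hη y hy v, smul_eq_mul]
    simp only [Matrix.mulVec, dotProduct, Pi.smul_apply, smul_eq_mul] at hcr
    rw [sub_eq_zero]
    refine hcr.symm.trans ?_
    exact Finset.sum_congr rfl fun j _ => mul_comm _ _
  obtain ⟨f, -, hf⟩ := (hfree z hz).1 Y hYan hYt
  have hf' := hf.self_of_nhds
  have hmemX : ∀ i, Xs i z ∈ Submodule.span ℂ (Set.range (Fin.append (fun a => Xs a z) v)) :=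
    fun i => Submodule.subset_span ⟨Fin.castAdd m i, by simp⟩
  have hmemv : ∀ j, v j ∈ Submodule.span ℂ (Set.range (Fin.append (fun a => Xs a z) v)) :=
    fun j => Submodule.subset_span ⟨Fin.natAdd k j, by simp⟩
  have h1 : ω z v • u ∈ Submodule.span ℂ (Set.range (Fin.append (fun a => Xs a z) v)) := by
    have : ω z v • u = ∑ i, f i z • Xs i z + ∑ j, ω z (Function.update v j u) • v j := by
      rw [← hf']; simp [Y]
    rw [this]
    exact Submodule.add_mem _ (Submodule.sum_mem _ fun i _ => Submodule.smul_mem _ _ (hmemX i))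
      (Submodule.sum_mem _ fun j _ => Submodule.smul_mem _ _ (hmemv j))
  exact (Submodule.smul_mem_iff _ hv).1 h1

theorem a_to_b {k m : ℕ} (hn : 2 ≤ k + m) {U : Set (Cn (k + m))} (hU : IsOpen U)
    {ω : Form (k + m) m} (hol : HolFormOn U ω) (hdec : LocallyDecomp U ω)
    (hcodim : CodimGE (k + m) {z ∈ U | ω z = 0} 2)
    {Xs : Fin k → VF (k + m)} (hXs : ∀ i, AnalyticOnNhd ℂ (Xs i) U)
    (htan : ∀ i, ∀ z ∈ U, TangentAt ω (Xs i) z) (hfree : ∀ z ∈ U, FreeGensAt ω Xs z) :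
    ∃ Θ : Form (k + m) (k + m), HolFormOn U Θ ∧
      ∀ z ∈ U, ω z = contr (Θ z) (fun a => Xs a z) := by
  let D : AlternatingMap ℂ (Cn (k + m)) ℂ (Fin (k + m)) := (Pi.basisFun ℂ (Fin (k + m))).det
  let β : Form (k + m) m := fun z => contr D (fun a => Xs a z)
  have hβne : ∀ z ∈ U, ω z ≠ 0 → ∃ v, β z v ≠ 0 := by
    intro z hz hne
    obtain ⟨v, hv⟩ : ∃ v, ω z v ≠ 0 := by
      by_contra hcon
      push Not at hcon
      exact hne (by ext w; simpa using hcon w)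
    refine ⟨v, ?_⟩
    have hli := spanning hol hdec hfree hz hv
    have hsp := hli.span_eq_top_of_card_eq_finrank' (by simp)
    exact ((Module.Basis.is_basis_iff_det _).1 ⟨hli, hsp⟩).ne_zero
  have hloc : ∀ c ∈ U, ∃ h : Cn (k + m) → ℂ, AnalyticAt ℂ h c ∧
      ∀ᶠ z in 𝓝 c, ∀ w, ω z w = h z * β z w := by
    intro c hc
    refine ext_codim hn (hU.mem_nhds hc) (A := fun w z => ω z w) (B := fun w z => β z w)
      (fun w => hol w) ?_ ?_ hcodim ?_
    · intro w z hz
      exact top_analytic (Θ := fun _ => D) (Y := fun i z => Fin.append (fun a => Xs a z) w i)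
          (fun v => analyticAt_const) (append_analytic (fun i => hXs i z hz) w)
    · intro z hz w w'
      by_cases h0 : ω z = 0
      · simp [h0]
      · obtain ⟨v, hv⟩ := hβne z hz h0
        obtain ⟨b, hb⟩ := basis_of_ne D _ hv
        have hp := prop_of_kills (ω z) (β z) (fun a => Xs a z) v b hb
          (fun i => htan i z hz) (contr_kills D _)
        have h1 := hp w
        have h2 := hp w'
        apply mul_right_cancel₀ hv
        linear_combination (β z w') * h1 - (β z w) * h2
    · intro z hz h
      refine ⟨hz, ?_⟩
      by_contra h0
      obtain ⟨v, hv⟩ := hβne z hz h0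
      exact hv (h v)
  choose! h han hh using hloc
  refine ⟨fun z => h z z • D, ?_, ?_⟩
  · intro v c hc
    have hgl : h c =ᶠ[𝓝 c] fun z => h z z := by
      have hUc : ∀ᶠ z in 𝓝 c, z ∈ U := hU.mem_nhds hc
      have hev := ((han c hc).eventually_continuousAt.and ((hh c hc).and hUc)).eventually_nhds
      filter_upwards [hev] with z hz
      obtain ⟨hz1, -, hz3⟩ := hz.self_of_nhds
      refine eq_of_freq hz1 (han z hz3).continuousAt ?_
      refine ((freq_ne hn hU hcodim hz3).and_eventually (hz.and (hh z hz3))).mono ?_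
      rintro z' ⟨hne, ⟨-, h2, h3⟩, h4⟩
      obtain ⟨w, hw⟩ := hβne z' h3 hne
      exact mul_right_cancel₀ hw ((h2 w).symm.trans (h4 w))
    have h1 : AnalyticAt ℂ (fun z => h c z * D v) c := (han c hc).mul analyticAt_const
    refine h1.congr ?_
    filter_upwards [hgl] with z hz
    simp [hz]
  · intro z hz
    ext w
    have := (hh z hz).self_of_nhds w
    rw [this]
    simp [contr_apply, β]

/-- Proposition 2.1: For a `k`-dimensional distribution on a polydisc
`U ⊆ ℂⁿ` defined by the `(n-k)`-form `ω`, and vector fields `X₁, …, X_k` on `U` defining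
one-dimensional foliations `G₁, …, G_k`, one has `T_D = T_{G₁} ⊕ ⋯ ⊕ T_{G_k}` if and
only if `ω = i_{X₁} ⋯ i_{X_k} Θ` for some holomorphic `n`-form `Θ` on `U`. -/
theorem statement_3 (n k m : ℕ) (hk : 1 ≤ k) (hm : 1 ≤ m) (hn : n = k + m)
    (U : Set (Cn n)) (hU : IsPolydisc U)
    (ω : Form n m) (hol : HolFormOn U ω) (hdec : LocallyDecomp U ω)
    (hcodim : CodimGE n {z ∈ U | ω z = 0} 2)
    (Xs : Fin k → VF n) (hXs : ∀ i, AnalyticOnNhd ℂ (Xs i) U)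
    (hXcodim : ∀ i, CodimGE n {z ∈ U | Xs i z = 0} 2) :
    ((∀ i, ∀ z ∈ U, TangentAt ω (Xs i) z) ∧ ∀ z ∈ U, FreeGensAt ω Xs z) ↔
      (∃ Θ : Form n n, HolFormOn U Θ ∧ ∀ z ∈ U, ∀ v : Fin m → Cn n,
        ω z v = Θ z (fun i => Fin.append (fun a => Xs a z) v (Fin.cast hn i))) := by
  subst hn
  have hUo := polydisc_open hU
  constructor
  · rintro ⟨htan, hfree⟩
    obtain ⟨Θ, h1, h2⟩ := a_to_b (by omega) hUo hol hdec hcodim hXs htan hfree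
    refine ⟨Θ, h1, fun z hz v => ?_⟩
    rw [h2 z hz, contr_apply]
    rfl
  · rintro ⟨Θ, h1, h2⟩
    refine b_to_a (by omega) hUo hcodim hXs h1 (fun z hz => ?_)
    ext v
    rw [h2 z hz, contr_apply]
    rfl
end

section
/- Let D be a two-dimensional singular holomorphic distribution on ℙ^n, n ≥ 3, and assume there exists a one-dimensional foliation G on ℙ^n which locally divides D (at every point of ℙ^n). Then there is a one-dimensional foliation H on ℙ^n tangent to D such that T_D = T_G ⊕ T_H; in particular T_D splits, and if d = deg(D) and e = deg(G) then T_D ≅ O_{ℙ^n}(1−e) ⊕ O_{ℙ^n}(1+e−d). -/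
open Topology Filter Set
open scoped ENNReal Manifold

namespace S5
open MvPolynomial

/-- proportional vectors in a UFD -/
lemma ufd_prop {R ι : Type*} [CommRing R] [IsDomain R] [UniqueFactorizationMonoid R] [Fintype ι]
    (f g : ι → R) (h : ∀ i j, f i * g j = f j * g i)
    (hf : ∀ p : R, Irreducible p → ∃ i, ¬ p ∣ f i) (hne : ∃ i, f i ≠ 0) :
    ∃ a : R, ∀ i, g i = a * f i := by
  classical
  obtain ⟨i, hi⟩ := hne
  let _ : StrongNormalizationMonoid R := UniqueFactorizationMonoid.strongNormalizationMonoid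
  let _ := UniqueFactorizationMonoid.toNormalizedGCDMonoid R
  have hu : IsUnit (Finset.univ.gcd f) := by
    by_contra hnu
    have hz : Finset.univ.gcd f ≠ 0 := by
      intro h0
      exact hi ((Finset.gcd_eq_zero_iff.1 h0) i (Finset.mem_univ i))
    obtain ⟨p, hp, hpd⟩ := WfDvdMonoid.exists_irreducible_factor hnu hz
    obtain ⟨j, hj⟩ := hf p hp
    exact hj (hpd.trans (Finset.gcd_dvd (Finset.mem_univ j)))
  have h1 : f i ∣ Finset.univ.gcd (fun j => f j * g i) :=
    Finset.dvd_gcd fun j _ => ⟨g j, (h i j).symm⟩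
  have h2 : f i ∣ g i := by
    have := h1.trans (Finset.gcd_mul_right' Finset.univ f (g i)).dvd
    exact (hu.dvd_mul_left).1 this
  obtain ⟨a, ha⟩ := h2
  refine ⟨a, fun j => mul_left_cancel₀ hi ?_⟩
  rw [h i j, ha]; ring

/-- `X k ^ r` is a nonzerodivisor modulo `(X i ^ r, X j ^ r)`. -/
lemma regular_step {σ : Type*} (i j k : σ) (hik : i ≠ k) (hjk : j ≠ k) (r : ℕ)
    (a b c : MvPolynomial σ ℂ) (h : X k ^ r * a - X j ^ r * b + X i ^ r * c = 0) :
    ∃ u v : MvPolynomial σ ℂ, a = X j ^ r * u - X i ^ r * v := by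
  classical
  have hspan : Ideal.span ((fun s : σ →₀ ℕ => monomial s (1 : ℂ)) ''
      {Finsupp.single i r, Finsupp.single j r}) = Ideal.span {X i ^ r, X j ^ r} := by
    congr 1
    simp [Set.image_pair, X_pow_eq_monomial]
  have hmem : X k ^ r * a ∈ Ideal.span ((fun s : σ →₀ ℕ => monomial s (1 : ℂ)) ''
      {Finsupp.single i r, Finsupp.single j r}) := by
    rw [hspan, Ideal.mem_span_pair]
    exact ⟨-c, b, by linear_combination -h⟩
  have ha : a ∈ Ideal.span ((fun s : σ →₀ ℕ => monomial s (1 : ℂ)) ''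
      {Finsupp.single i r, Finsupp.single j r}) := by
    rw [mem_ideal_span_monomial_image] at hmem ⊢
    intro x hx
    have hx' : Finsupp.single k r + x ∈ (X k ^ r * a).support := by
      rw [mem_support_iff, X_pow_eq_monomial, coeff_monomial_mul]
      simpa using hx
    obtain ⟨s, hs, hle⟩ := hmem _ hx'
    refine ⟨s, hs, ?_⟩
    intro t
    have := hle t
    rcases hs with rfl | rfl
    · by_cases hti : i = t
      · subst hti
        simpa [Finsupp.single_apply, hik.symm] using this
      · simp [hti]
    · by_cases hti : j = t
      · subst hti
        simpa [Finsupp.single_apply, hjk.symm] using this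
      · simp [hti]
  rw [hspan, Ideal.mem_span_pair] at ha
  obtain ⟨p, q, hpq⟩ := ha
  exact ⟨q, -p, by linear_combination -hpq⟩

/-- Koszul gluing. -/
lemma koszul {σ J : Type*} [Fintype σ] (i j k : σ) (hij : i ≠ j) (hik : i ≠ k) (hjk : j ≠ k)
    (φ : (σ → MvPolynomial σ ℂ) →ₗ[MvPolynomial σ ℂ] (J → MvPolynomial σ ℂ))
    (V Z : σ → MvPolynomial σ ℂ)
    (hV : φ V = 0) (hZ : φ Z = 0)
    (hker : ∀ Y, φ Y = 0 → ∃ a b : MvPolynomial σ ℂ, Y = a • V + b • Z)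
    (hind : ∀ a b : MvPolynomial σ ℂ, a • V + b • Z = 0 → a = 0 ∧ b = 0)
    (w : J → MvPolynomial σ ℂ) (r : ℕ)
    (hw : ∀ s : σ, ∃ Y, φ Y = (X s ^ r : MvPolynomial σ ℂ) • w) :
    ∃ Y, φ Y = w := by
  obtain ⟨Y0, h0⟩ := hw i
  obtain ⟨Y1, h1⟩ := hw j
  obtain ⟨Y2, h2⟩ := hw k
  obtain ⟨a01, b01, e01⟩ := hker ((X j ^ r : MvPolynomial σ ℂ) • Y0 - (X i ^ r : MvPolynomial σ ℂ) • Y1) (by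
    rw [map_sub, map_smul, map_smul, h0, h1, smul_comm, sub_self])
  obtain ⟨a02, b02, e02⟩ := hker ((X k ^ r : MvPolynomial σ ℂ) • Y0 - (X i ^ r : MvPolynomial σ ℂ) • Y2) (by
    rw [map_sub, map_smul, map_smul, h0, h2, smul_comm, sub_self])
  obtain ⟨a12, b12, e12⟩ := hker ((X k ^ r : MvPolynomial σ ℂ) • Y1 - (X j ^ r : MvPolynomial σ ℂ) • Y2) (by
    rw [map_sub, map_smul, map_smul, h1, h2, smul_comm, sub_self])
  obtain ⟨ha, hb⟩ := hind (X k ^ r * a01 - X j ^ r * a02 + X i ^ r * a12)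
      (X k ^ r * b01 - X j ^ r * b02 + X i ^ r * b12) (by
    ext1 t
    have t01 := congrFun e01 t
    have t02 := congrFun e02 t
    have t12 := congrFun e12 t
    simp only [Pi.add_apply, Pi.sub_apply, Pi.smul_apply, smul_eq_mul, Pi.zero_apply] at *
    linear_combination (-X k ^ r) * t01 + X j ^ r * t02 - X i ^ r * t12)
  obtain ⟨α0, α1, hα⟩ := regular_step i j k hik hjk r _ _ _ ha
  obtain ⟨β0, β1, hβ⟩ := regular_step i j k hik hjk r _ _ _ hb
  have hdvd : ∀ t, ∃ y, Y0 t - α0 * V t - β0 * Z t = X i ^ r * y := by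
    intro t
    have : (X i ^ r : MvPolynomial σ ℂ) ∣ X j ^ r * (Y0 t - α0 * V t - β0 * Z t) := by
      refine ⟨Y1 t - α1 * V t - β1 * Z t, ?_⟩
      have t01 := congrFun e01 t
      simp only [Pi.add_apply, Pi.sub_apply, Pi.smul_apply, smul_eq_mul] at t01
      linear_combination t01 + V t * hα + Z t * hβ
    have hp : Prime (X i : MvPolynomial σ ℂ) := X_prime
    refine hp.pow_dvd_of_dvd_mul_left r ?_ this
    intro hd
    exact hij (X_dvd_X.1 (hp.dvd_of_dvd_pow hd))
  choose Y hY using hdvd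
  refine ⟨Y, ?_⟩
  have hX : (X i ^ r : MvPolynomial σ ℂ) ≠ 0 := pow_ne_zero _ (X_ne_zero i)
  have : (X i ^ r : MvPolynomial σ ℂ) • φ Y = (X i ^ r : MvPolynomial σ ℂ) • w := by
    rw [← map_smul, ← h0]
    have : (X i ^ r : MvPolynomial σ ℂ) • Y = Y0 - α0 • V - β0 • Z := by
      ext1 t
      simp [← hY t]
    rw [this, map_sub, map_sub, map_smul, map_smul, hV, hZ]; simp
  ext1 t
  exact mul_left_cancel₀ hX (congrFun this t)

/-- Krull + Nullstellensatz. -/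
lemma local_to_power {N : ℕ} {M : Type*} [AddCommGroup M] [Module (MvPolynomial (Fin N) ℂ) M]
    [Module.Finite (MvPolynomial (Fin N) ℂ) M] (S : Submodule (MvPolynomial (Fin N) ℂ) M) (w : M)
    (h : ∀ q : Fin N → ℂ, q ≠ 0 → ∀ k : ℕ,
      ∃ y ∈ S, w - y ∈ (Ideal.span (Set.range fun i => (X i - C (q i) : MvPolynomial (Fin N) ℂ))) ^ k
        • (⊤ : Submodule (MvPolynomial (Fin N) ℂ) M)) :
    ∃ r : ℕ, ∀ s : Fin N, (X s ^ r : MvPolynomial (Fin N) ℂ) • w ∈ S := by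
  let I : Ideal (MvPolynomial (Fin N) ℂ) := S.colon {w}
  have hI : ∀ f, f ∈ I ↔ f • w ∈ S := fun f => Submodule.mem_colon_singleton
  have hpt : ∀ q : Fin N → ℂ, q ≠ 0 → ∃ f ∈ I, eval q f ≠ 0 := by
    intro q hq
    set m := Ideal.span (Set.range fun i => (X i - C (q i) : MvPolynomial (Fin N) ℂ)) with hm
    have hK : S.mkQ w ∈ (⨅ k : ℕ, m ^ k • ⊤ : Submodule (MvPolynomial (Fin N) ℂ) (M ⧸ S)) := by
      rw [Submodule.mem_iInf]
      intro k
      obtain ⟨y, hy, hwy⟩ := h q hq k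
      have : S.mkQ w = S.mkQ (w - y) := by
        rw [map_sub, (Submodule.Quotient.mk_eq_zero S (x := y)).2 hy |> fun h => (show S.mkQ y = 0 from h), sub_zero]
      rw [this]
      have h2 := Submodule.mem_map_of_mem (f := S.mkQ) hwy
      rw [Submodule.map_smul''] at h2
      exact Submodule.smul_mono le_rfl le_top h2
    rw [Ideal.mem_iInf_smul_pow_eq_bot_iff] at hK
    obtain ⟨⟨r, hr⟩, hrw⟩ := hK
    refine ⟨1 - r, ?_, ?_⟩
    · rw [hI, ← Submodule.Quotient.mk_eq_zero, sub_smul, one_smul]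
      have : S.mkQ (w - r • w) = 0 := by
        rw [map_sub, map_smul]; exact sub_eq_zero.2 hrw.symm
      exact this
    · have : m ≤ RingHom.ker (eval q) := by
        rw [hm, Ideal.span_le]
        rintro _ ⟨i, rfl⟩
        simp
      have hr0 : eval q r = 0 := this hr
      simp [hr0]
  have hrad : ∀ s : Fin N, (X s : MvPolynomial (Fin N) ℂ) ∈ I.radical := by
    intro s
    rw [← vanishingIdeal_zeroLocus_eq_radical (k := ℂ) (K := ℂ)]
    rw [mem_vanishingIdeal_iff]
    intro q hq
    by_cases h0 : q = 0
    · simp [h0]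
    · obtain ⟨f, hf, hne⟩ := hpt q h0
      exact absurd (by simpa using hq f hf) hne
  choose r hr using hrad
  refine ⟨∑ s, r s, fun s => ?_⟩
  rw [← hI]
  exact Ideal.pow_mem_of_pow_mem I (hr s) (Finset.single_le_sum (fun _ _ => Nat.zero_le _) (Finset.mem_univ s))

end S5

namespace S5
open MvPolynomial

lemma mul_poly {N k : ℕ} (p : ContinuousMultilinearMap ℂ (fun _ : Fin k => Fin N → ℂ) ℂ) :
    ∃ P : MvPolynomial (Fin N) ℂ, ∀ z, eval z P = p (fun _ => z) := by
  classical
  refine ⟨∑ r : Fin k → Fin N, C (p fun i => Pi.single (r i) 1) * ∏ i, X (r i), fun z => ?_⟩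
  have hz : (fun _ : Fin k => z) = fun _ => ∑ j, z j • (Pi.single j (1 : ℂ) : Fin N → ℂ) := by
    funext _
    ext t
    simp [Finset.sum_apply, Pi.single_apply]
  rw [hz, ContinuousMultilinearMap.map_sum]
  simp only [map_sum, map_mul, eval_C, map_prod, eval_X]
  refine Finset.sum_congr rfl fun r _ => ?_
  rw [ContinuousMultilinearMap.map_smul_univ, smul_eq_mul, mul_comm]

lemma taylor {N : ℕ} (f : (Fin N → ℂ) → ℂ) (q : Fin N → ℂ) (hf : AnalyticAt ℂ f q) (k : ℕ) :
    ∃ P : MvPolynomial (Fin N) ℂ,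
      (fun y => f (q + y) - eval y P) =O[𝓝 0] fun y => ‖y‖ ^ k := by
  obtain ⟨p, hp⟩ := hf
  have h := hp.isBigO_sub_partialSum_pow k
  choose P hP using fun h => mul_poly (p h)
  refine ⟨∑ h ∈ Finset.range k, P h, ?_⟩
  refine h.congr_left fun y => ?_
  simp [FormalMultilinearSeries.partialSum, hP]

lemma uni (k : ℕ) : ∀ U : Polynomial ℂ,
    (fun t => U.eval t) =O[𝓝[≠] (0 : ℂ)] (fun t => t ^ k) → Polynomial.X ^ k ∣ U := by
  induction k with
  | zero => intro U _; simp
  | succ k ih =>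
    intro U hU
    have h0 : U.eval 0 = 0 := by
      have h1 : Tendsto (fun t : ℂ => t ^ (k + 1)) (𝓝[≠] (0 : ℂ)) (𝓝 0) := by
        have : Tendsto (fun t : ℂ => t ^ (k + 1)) (𝓝 (0 : ℂ)) (𝓝 (0 ^ (k + 1))) :=
          (continuous_pow (k + 1)).tendsto 0
        rw [zero_pow (Nat.succ_ne_zero k)] at this
        exact this.mono_left nhdsWithin_le_nhds
      have h2 := hU.trans_tendsto h1
      have h3 : Tendsto (fun t => U.eval t) (𝓝[≠] (0 : ℂ)) (𝓝 (U.eval 0)) :=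
        (U.continuous.tendsto 0).mono_left nhdsWithin_le_nhds
      exact tendsto_nhds_unique h3 h2
    obtain ⟨U1, rfl⟩ : Polynomial.X ∣ U := by
      rw [Polynomial.X_dvd_iff, Polynomial.coeff_zero_eq_eval_zero, h0]
    rw [pow_succ']
    refine mul_dvd_mul_left _ (ih U1 ?_)
    rw [Asymptotics.isBigO_iff] at hU ⊢
    obtain ⟨c, hc⟩ := hU
    refine ⟨c, ?_⟩
    filter_upwards [hc, self_mem_nhdsWithin] with t ht ht0
    have hpos : 0 < ‖t‖ := norm_pos_iff.2 ht0
    simp only [Polynomial.eval_mul, Polynomial.eval_X, norm_mul, norm_pow] at ht ⊢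
    rw [pow_succ'] at ht
    have : ‖t‖ * ‖U1.eval t‖ ≤ ‖t‖ * (c * ‖t‖ ^ k) := by linarith
    exact le_of_mul_le_mul_left this hpos

lemma homog_eval {N k : ℕ} {P : MvPolynomial (Fin N) ℂ} (hP : P.IsHomogeneous k) (t : ℂ)
    (z : Fin N → ℂ) : eval (t • z) P = t ^ k * eval z P := by
  rw [eval_eq, eval_eq, Finset.mul_sum]
  refine Finset.sum_congr rfl fun d hd => ?_
  have hk := hP.degree_eq_sum_deg_support hd
  simp only [Pi.smul_apply, smul_eq_mul, mul_pow, Finset.prod_mul_distrib]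
  rw [Finset.prod_pow_eq_pow_sum, hk]
  have : ∑ i ∈ d.support, d i = d.degree := rfl
  rw [this]; ring

/-- restriction of a polynomial to a line through the origin -/
noncomputable def line {N : ℕ} (P : MvPolynomial (Fin N) ℂ) (z : Fin N → ℂ) : Polynomial ℂ :=
  ∑ h ∈ Finset.range (P.totalDegree + 1), Polynomial.C (eval z (homogeneousComponent h P)) * Polynomial.X ^ h

lemma line_eval {N : ℕ} (P : MvPolynomial (Fin N) ℂ) (z : Fin N → ℂ) (t : ℂ) :
    (line P z).eval t = eval (t • z) P := by
  conv_rhs => rw [← sum_homogeneousComponent P]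
  rw [line, Polynomial.eval_finsetSum, map_sum]
  refine Finset.sum_congr rfl fun h _ => ?_
  rw [homog_eval (homogeneousComponent_isHomogeneous h P), Polynomial.eval_mul, Polynomial.eval_C,
    Polynomial.eval_pow, Polynomial.eval_X, mul_comm]

lemma line_coeff {N : ℕ} (P : MvPolynomial (Fin N) ℂ) (z : Fin N → ℂ) (h : ℕ) :
    (line P z).coeff h = eval z (homogeneousComponent h P) := by
  rw [line, Polynomial.finsetSum_coeff]
  simp only [Polynomial.coeff_C_mul, Polynomial.coeff_X_pow]
  simp only [mul_ite, mul_one, mul_zero, Finset.sum_ite_eq, Finset.mem_range]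
  split_ifs with hh
  · rfl
  · rw [homogeneousComponent_eq_zero h P (by omega), map_zero]

lemma line_bigO {N : ℕ} (F : (Fin N → ℂ) → ℂ) (z : Fin N → ℂ) (k : ℕ)
    (h : F =O[𝓝 0] fun y => ‖y‖ ^ k) :
    (fun t : ℂ => F (t • z)) =O[𝓝[≠] (0 : ℂ)] (fun t => t ^ k) := by
  have ht : Tendsto (fun t : ℂ => t • z) (𝓝[≠] (0 : ℂ)) (𝓝 0) := by
    have : Tendsto (fun t : ℂ => t • z) (𝓝 (0 : ℂ)) (𝓝 ((0 : ℂ) • z)) :=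
      (continuous_id.smul continuous_const).tendsto 0
    rw [zero_smul] at this
    exact this.mono_left nhdsWithin_le_nhds
  refine (h.comp_tendsto ht).trans ?_
  refine Asymptotics.IsBigO.of_bound (‖z‖ ^ k) (Eventually.of_forall fun t => ?_)
  simp [norm_smul, mul_pow, mul_comm]

/-- homogeneous analytic functions are polynomials -/
lemma homog_poly {N : ℕ} (f : (Fin N → ℂ) → ℂ) (k : ℕ) (hf : AnalyticAt ℂ f 0)
    (hh : ∀ (t : ℂ) z, f (t • z) = t ^ k * f z) :
    ∃ P : MvPolynomial (Fin N) ℂ, P.IsHomogeneous k ∧ ∀ z, eval z P = f z := by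
  obtain ⟨T, hT⟩ := taylor f 0 hf (k + 1)
  refine ⟨homogeneousComponent k T, homogeneousComponent_isHomogeneous k T, fun z => ?_⟩
  have h1 := line_bigO _ z _ hT
  have h2 : Polynomial.X ^ (k + 1) ∣ (Polynomial.C (f z) * Polynomial.X ^ k - line T z) := by
    apply uni
    refine h1.congr_left fun t => ?_
    rw [Polynomial.eval_sub, line_eval, Polynomial.eval_mul, Polynomial.eval_C,
      Polynomial.eval_pow, Polynomial.eval_X, zero_add, hh, mul_comm]
  rw [Polynomial.X_pow_dvd_iff] at h2
  have := h2 k (Nat.lt_succ_self k)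
  rw [Polynomial.coeff_sub, Polynomial.coeff_C_mul, line_coeff, Polynomial.coeff_X_pow] at this
  simp only [if_true, mul_one] at this
  exact (sub_eq_zero.1 this).symm

/-- order of vanishing at a point -/
lemma order_mem {N : ℕ} (P : MvPolynomial (Fin N) ℂ) (q : Fin N → ℂ) (k : ℕ)
    (h : (fun y => eval (q + y) P) =O[𝓝 0] fun y => ‖y‖ ^ k) :
    P ∈ (Ideal.span (Set.range fun i => (X i - C (q i) : MvPolynomial (Fin N) ℂ))) ^ k := by
  let τ : MvPolynomial (Fin N) ℂ →ₐ[ℂ] MvPolynomial (Fin N) ℂ := aeval fun i => X i + C (q i)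
  let σ : MvPolynomial (Fin N) ℂ →ₐ[ℂ] MvPolynomial (Fin N) ℂ := aeval fun i => X i - C (q i)
  have hτ : ∀ y, eval y (τ P) = eval (q + y) P := by
    intro y
    have : (eval y).comp (τ : MvPolynomial (Fin N) ℂ →+* MvPolynomial (Fin N) ℂ) = eval (q + y) := by
      ext i <;> simp [τ, add_comm]
    exact congrArg (fun g : MvPolynomial (Fin N) ℂ →+* ℂ => g P) this
  have hστ : σ (τ P) = P := by
    have : σ.comp τ = AlgHom.id ℂ _ := by
      ext i; simp [τ, σ]
    exact congrArg (fun g : MvPolynomial (Fin N) ℂ →ₐ[ℂ] MvPolynomial (Fin N) ℂ => g P) this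
  have hmem : τ P ∈ idealOfVars (Fin N) ℂ ^ k := by
    rw [mem_pow_idealOfVars_iff']
    intro x hx
    have hc : homogeneousComponent x.degree (τ P) = 0 := by
      apply MvPolynomial.funext
      intro z
      rw [map_zero, ← line_coeff]
      have : Polynomial.X ^ k ∣ line (τ P) z := by
        apply uni
        convert line_bigO _ z _ h using 2 with t
        rw [line_eval, hτ]
      exact Polynomial.X_pow_dvd_iff.1 this _ hx
    have := congrArg (coeff x) hc
    rwa [coeff_homogeneousComponent, if_pos rfl, coeff_zero] at this
  have h3 := Ideal.mem_map_of_mem (σ : MvPolynomial (Fin N) ℂ →+* MvPolynomial (Fin N) ℂ) hmem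
  rw [Ideal.map_pow, Ideal.map_span, ← Set.range_comp] at h3
  have h4 : (σ : MvPolynomial (Fin N) ℂ →+* MvPolynomial (Fin N) ℂ) (τ P) = P := hστ
  rw [h4] at h3
  have h5 : ((σ : MvPolynomial (Fin N) ℂ →+* MvPolynomial (Fin N) ℂ) ∘ X) =
      fun i => (X i - C (q i) : MvPolynomial (Fin N) ℂ) := by
    funext i
    simp [σ]
  rwa [h5] at h3

/-- hypersurfaces are not of codimension two -/
lemma hyp_not_codim {N : ℕ} (g : MvPolynomial (Fin (N + 2)) ℂ) (hg : g ≠ 0) (hu : ¬ IsUnit g) :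
    (2 * (N + 1 : ℕ) : ℝ≥0∞) ≤ dimH {z : Fin (N + 2) → ℂ | z ≠ 0 ∧ eval z g = 0} := by
  obtain ⟨i, hi⟩ : ∃ i, degreeOf i g ≠ 0 := by
    by_contra hcon
    push Not at hcon
    apply hu
    have : g.totalDegree = 0 := by
      rw [totalDegree_eq_zero_iff]
      intro m hm x
      exact Nat.le_zero.1 ((hcon x) ▸ (monomial_le_degreeOf x hm))
    rw [totalDegree_eq_zero_iff_eq_C] at this
    rw [this] at hg ⊢
    refine (isUnit_iff_ne_zero.2 ?_).map C
    intro h0; rw [h0] at hg; simp at hg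
  let s := Equiv.swap 0 i
  set g' := rename s g with hg'
  have hd : degreeOf 0 g' ≠ 0 := by
    have : (0 : Fin (N + 2)) = s i := by simp [s]
    rw [this, hg', degreeOf_rename_of_injective s.injective]; exact hi
  have hP : (finSuccEquiv ℂ (N + 1) g').natDegree ≠ 0 := by rwa [natDegree_finSuccEquiv]
  set P := finSuccEquiv ℂ (N + 1) g' with hPdef
  have hlc : P.leadingCoeff ≠ 0 := by
    intro h0
    rw [Polynomial.leadingCoeff_eq_zero] at h0
    rw [h0] at hP; simp at hP
  let π : (Fin (N + 2) → ℂ) →L[ℂ] (Fin (N + 1) → ℂ) :=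
    ContinuousLinearMap.pi fun j => ContinuousLinearMap.proj (s j.succ)
  have hsub : {y : Fin (N + 1) → ℂ | eval y (X 0 * P.leadingCoeff) ≠ 0} ⊆
      π '' {z : Fin (N + 2) → ℂ | z ≠ 0 ∧ eval z g = 0} := by
    intro y hy
    simp only [mem_ofPred_eq, map_mul, eval_X, mul_ne_zero_iff] at hy
    have hdeg : (P.map (eval y)).degree ≠ 0 := by
      rw [Polynomial.degree_map_eq_of_leadingCoeff_ne_zero _ hy.2]
      intro h0
      exact hP (Polynomial.natDegree_eq_of_degree_eq_some h0)
    obtain ⟨t, ht⟩ := IsAlgClosed.exists_root _ hdeg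
    have h1 : eval (Fin.cons t y : Fin (N + 2) → ℂ) g' = 0 := by
      rw [eval_eq_eval_mv_eval']; exact ht
    rw [hg', eval_rename] at h1
    have h2 : π ((Fin.cons t y : Fin (N + 2) → ℂ) ∘ s) = y := by
      ext j
      simp [π, s]
    refine ⟨_, ⟨?_, h1⟩, h2⟩
    intro h0
    rw [h0, map_zero] at h2
    exact hy.1 (by rw [← h2]; rfl)
  have hne : (X 0 * P.leadingCoeff : MvPolynomial (Fin (N + 1)) ℂ) ≠ 0 := mul_ne_zero (X_ne_zero 0) hlc
  obtain ⟨y0, hy0⟩ : ∃ y, eval y (X 0 * P.leadingCoeff) ≠ 0 := by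
    by_contra hcon
    push Not at hcon
    exact hne (MvPolynomial.funext fun y => by rw [hcon y, map_zero])
  have hopen : IsOpen {y : Fin (N + 1) → ℂ | eval y (X 0 * P.leadingCoeff) ≠ 0} :=
    isOpen_ne_fun (MvPolynomial.continuous_eval _) continuous_const
  have hdim := Real.dimH_of_nonempty_interior (s := {y : Fin (N + 1) → ℂ | eval y (X 0 * P.leadingCoeff) ≠ 0})
    ⟨y0, by rw [hopen.interior_eq]; exact hy0⟩
  have hfr : Module.finrank ℝ (Fin (N + 1) → ℂ) = (N + 1) * 2 := by
    rw [Module.finrank_pi_fintype]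
    simp [Complex.finrank_real_complex]
  rw [hfr] at hdim
  calc (2 * (N + 1 : ℕ) : ℝ≥0∞) = (((N + 1) * 2 : ℕ) : ℝ≥0∞) := by push_cast; ring
    _ ≤ _ := by
      rw [← hdim]
      exact (dimH_mono hsub).trans (π.lipschitz.dimH_image_le _)

end S5

namespace S5
open MvPolynomial

/-- `v ↦ det (V, Y, Z, v)` -/
noncomputable def dd {S : Type*} [CommRing S] {m : ℕ} (V Y Z : Fin (m + 3) → S) :
    AlternatingMap S (Fin (m + 3) → S) S (Fin m) :=
  (((Matrix.detRowAlternating (n := Fin (m + 3)) (R := S)).curryLeft V).curryLeft Y).curryLeft Z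

lemma dd_apply {S : Type*} [CommRing S] {m : ℕ} (V Y Z : Fin (m + 3) → S)
    (v : Fin m → Fin (m + 3) → S) :
    dd V Y Z v = Matrix.det (Matrix.of (Fin.cons V (Fin.cons Y (Fin.cons Z v)) :
      Fin (m + 3) → Fin (m + 3) → S)) := rfl

lemma append_eq {S : Type*} {m : ℕ} (hn : m + 2 + 1 = 3 + m) (V Y Z : S)
    (v : Fin m → S) :
    (fun i => Fin.append ![V, Y, Z] v (Fin.cast hn i)) =
      (Fin.cons V (Fin.cons Y (Fin.cons Z v)) : Fin (m + 3) → S) := by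
  funext i
  refine Fin.cases ?_ (fun i => ?_) i
  · exact Fin.append_left ![V, Y, Z] v 0
  refine Fin.cases ?_ (fun i => ?_) i
  · exact Fin.append_left ![V, Y, Z] v 1
  refine Fin.cases ?_ (fun i => ?_) i
  · exact Fin.append_left ![V, Y, Z] v 2
  have : Fin.cast hn i.succ.succ.succ = Fin.natAdd 3 i := by
    ext; simp; omega
  rw [this, Fin.append_right]
  simp

lemma dd_map {S T : Type*} [CommRing S] [CommRing T] (f : S →+* T) {m : ℕ}
    (V Y Z : Fin (m + 3) → S) (v : Fin m → Fin (m + 3) → S) :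
    f (dd V Y Z v) = dd (fun i => f (V i)) (fun i => f (Y i)) (fun i => f (Z i))
      (fun k i => f (v k i)) := by
  rw [dd_apply, dd_apply, RingHom.map_det]
  congr 1
  ext i j
  refine Fin.cases ?_ (fun i => ?_) i
  · simp
  refine Fin.cases ?_ (fun i => ?_) i
  · simp
  refine Fin.cases ?_ (fun i => ?_) i
  · rfl
  simp

lemma dd_linear {S : Type*} [CommRing S] {m : ℕ} (V Y Z : Fin (m + 3) → S)
    (v : Fin m → Fin (m + 3) → S) :
    dd V Y Z v = ∑ j, dd V (Pi.single j 1) Z v * Y j := by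
  have hY : Y = ∑ j, Y j • (Pi.single j (1 : S) : Fin (m + 3) → S) := by
    ext t
    simp [Finset.sum_apply, Pi.single_apply]
  let L : (Fin (m + 3) → S) →ₗ[S] S :=
    { toFun := fun Y => dd V Y Z v
      map_add' := fun A B => by
        simp [dd, map_add, AlternatingMap.curryLeft_add]
      map_smul' := fun c A => by
        simp [dd, map_smul, AlternatingMap.curryLeft_smul] }
  change L Y = _
  conv_lhs => rw [hY]
  rw [map_sum]
  refine Finset.sum_congr rfl fun j _ => ?_
  rw [map_smul, smul_eq_mul, mul_comm]
  rfl

lemma dd_self_left {S : Type*} [CommRing S] {m : ℕ} (V Z : Fin (m + 3) → S)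
    (v : Fin m → Fin (m + 3) → S) : dd V V Z v = 0 :=
  Matrix.det_zero_of_row_eq (i := 0) (j := 1) (by simp) rfl

lemma dd_self_right {S : Type*} [CommRing S] {m : ℕ} (V Z : Fin (m + 3) → S)
    (v : Fin m → Fin (m + 3) → S) : dd V Z Z v = 0 :=
  Matrix.det_zero_of_row_eq (i := 1) (j := 2) (by intro h; have := congrArg Fin.val h; simp at this; rw [Nat.mod_eq_of_lt (by omega)] at this; omega) rfl

lemma dd_swap {S : Type*} [CommRing S] {m : ℕ} (V Y Z : Fin (m + 3) → S)
    (v : Fin m → Fin (m + 3) → S) : dd Y V Z v = - dd V Y Z v := by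
  have h := dd_self_left (V + Y) Z v
  have h1 := dd_self_left V Z v
  have h2 := dd_self_left Y Z v
  simp only [dd, map_add, AlternatingMap.curryLeft_add, LinearMap.add_apply, AlternatingMap.add_apply] at h h1 h2 ⊢
  rw [h1, h2] at h
  linear_combination h

lemma dd_mem {S : Type*} [CommRing S] {m : ℕ} (V Y Z : Fin (m + 3) → S)
    (v : Fin m → Fin (m + 3) → S) (i : Fin m) (h : v i = Y) : dd V Y Z v = 0 := by
  refine Matrix.det_zero_of_row_eq (i := 1) (j := i.succ.succ.succ) ?_ ?_
  · intro h; simp [Fin.ext_iff] at h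
  · exact h.symm

lemma dd_dep {m : ℕ} (V Y Z : Fin (m + 3) → ℂ) (h : ∀ v, dd V Y Z v = 0) :
    ¬ LinearIndependent ℂ ![V, Y, Z] := by
  intro hli
  obtain ⟨T, hT⟩ := Submodule.exists_isCompl (Submodule.span ℂ (Set.range ![V, Y, Z]))
  have hd := Submodule.finrank_add_eq_of_isCompl hT
  rw [finrank_span_eq_card hli] at hd
  simp only [Fintype.card_fin, Module.finrank_fin_fun] at hd
  let b := Module.finBasisOfFinrankEq ℂ T (show Module.finrank ℂ T = m by omega)
  have hb : LinearIndependent ℂ (fun i => (b i : Fin (m + 3) → ℂ)) :=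
    b.linearIndependent.map' T.subtype (Submodule.ker_subtype T)
  have hspan : Submodule.span ℂ (Set.range fun i => (b i : Fin (m + 3) → ℂ)) ≤ T := by
    rw [Submodule.span_le]
    rintro _ ⟨i, rfl⟩
    exact (b i).2
  have hs := hli.sum_type hb (hT.disjoint.mono_right hspan)
  have hn : m + 2 + 1 = 3 + m := by omega
  have h2 := hs.comp (fun i : Fin (m + 3) => finSumFinEquiv.symm (Fin.cast hn i))
    (finSumFinEquiv.symm.injective.comp (Fin.cast_injective hn))
  have h3 : (Sum.elim ![V, Y, Z] (fun i => (b i : Fin (m + 3) → ℂ)) ∘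
      (fun i : Fin (m + 3) => finSumFinEquiv.symm (Fin.cast hn i))) =
      (fun i => Fin.append ![V, Y, Z] (fun i => (b i : Fin (m + 3) → ℂ)) (Fin.cast hn i)) := by
    funext i
    obtain ⟨x, hx⟩ := finSumFinEquiv.surjective (Fin.cast hn i)
    simp only [Function.comp_apply, ← hx, Equiv.symm_apply_apply]
    rcases x with x | x <;> simp
  rw [h3, append_eq] at h2
  have h4 := Matrix.linearIndependent_rows_iff_isUnit (K := ℂ)
    (A := Matrix.of (Fin.cons V (Fin.cons Y (Fin.cons Z (fun i => (b i : Fin (m + 3) → ℂ)))) :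
      Fin (m + 3) → Fin (m + 3) → ℂ))
  have h5 := h4.1 h2
  rw [Matrix.isUnit_iff_isUnit_det, ← dd_apply, h] at h5
  exact not_isUnit_zero h5

/-- forms of corank one are interior products of the volume form -/
lemma theta {M : ℕ} (Θ : AlternatingMap ℂ (Fin (M + 1) → ℂ) ℂ (Fin M))
    (w : Fin M → Fin (M + 1) → ℂ) :
    Θ w = Matrix.det (Matrix.of (Fin.cons
      (fun j => (-1) ^ (j : ℕ) * Θ (fun i => Pi.single (j.succAbove i) 1)) w :
        Fin (M + 1) → Fin (M + 1) → ℂ)) := by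
  set Y : Fin (M + 1) → ℂ := fun j => (-1) ^ (j : ℕ) * Θ (fun i => Pi.single (j.succAbove i) 1) with hY
  have : Θ = (Matrix.detRowAlternating (n := Fin (M + 1)) (R := ℂ)).curryLeft Y := by
    refine Module.Basis.ext_alternating (Pi.basisFun ℂ (Fin (M + 1))) fun τ hτ => ?_
    obtain ⟨j, hj⟩ : ∃ j, j ∉ Set.range τ := by
      by_contra hcon
      push Not at hcon
      have := Fintype.card_le_of_surjective τ hcon
      simp at this
    choose σ hσ using fun i => Fin.exists_succAbove_eq (x := τ i) (y := j) (fun h => hj ⟨i, h⟩)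
    have hσi : Function.Injective σ := fun a b hab => hτ (by rw [← hσ a, ← hσ b, hab])
    let e : Equiv.Perm (Fin M) := Equiv.ofBijective σ (Finite.injective_iff_bijective.1 hσi)
    have hL : Θ (fun i => Pi.basisFun ℂ (Fin (M + 1)) (τ i)) =
        (Equiv.Perm.sign e : ℤ) * Θ (fun i => Pi.single (j.succAbove i) 1) := by
      have := Θ.map_perm (fun i => Pi.single (j.succAbove i) 1) e
      rw [Units.smul_def, zsmul_eq_mul] at this
      rw [← this]
      congr 1
      funext i
      simp [e, hσ]
    rw [hL]
    change _ = Matrix.det (Matrix.of (Fin.cons Y (fun i => Pi.basisFun ℂ (Fin (M + 1)) (τ i)) :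
        Fin (M + 1) → Fin (M + 1) → ℂ))
    rw [Matrix.det_succ_row_zero, Finset.sum_eq_single j]
    · have : (Matrix.of (Fin.cons Y (fun i => Pi.basisFun ℂ (Fin (M + 1)) (τ i)) :
        Fin (M + 1) → Fin (M + 1) → ℂ)).submatrix Fin.succ j.succAbove =
          (1 : Matrix (Fin M) (Fin M) ℂ).submatrix e id := by
        ext a b
        simp [e, Matrix.one_apply, Pi.single_apply, ← hσ, eq_comm]
      rw [this, Matrix.det_permute, Matrix.det_one]
      simp only [Matrix.of_apply, Fin.cons_zero, hY]
      have h1 : ((-1 : ℂ) ^ (j : ℕ)) * (-1) ^ (j : ℕ) = 1 := by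
        rw [← mul_pow]; simp
      linear_combination (-(Equiv.Perm.sign e : ℤ) * Θ (fun i => Pi.single (j.succAbove i) 1)) * h1
    · intro k _ hkj
      obtain ⟨i, hi⟩ := Fin.exists_succAbove_eq hkj
      have hk : τ (e.symm i) = k := by
        rw [← hσ, ← hi]
        congr 1
        exact e.apply_symm_apply i
      have : Matrix.det ((Matrix.of (Fin.cons Y (fun i => Pi.basisFun ℂ (Fin (M + 1)) (τ i)) :
        Fin (M + 1) → Fin (M + 1) → ℂ)).submatrix Fin.succ k.succAbove) = 0 := by
        apply Matrix.det_eq_zero_of_row_eq_zero (e.symm i)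
        intro b
        simp [hk]
      rw [this, mul_zero]
    · simp
  conv_lhs => rw [this]
  rfl

end S5

namespace S5
open MvPolynomial

lemma dd_ext_zero {m : ℕ} (V Y Z : Fin (m + 3) → ℂ)
    (h : ∀ I : Fin m → Fin (m + 3), dd V Y Z (fun k => Pi.single (I k) 1) = 0)
    (v : Fin m → Fin (m + 3) → ℂ) : dd V Y Z v = 0 := by
  have : dd V Y Z = 0 := by
    refine Module.Basis.ext_alternating (Pi.basisFun ℂ (Fin (m + 3))) fun τ _ => ?_
    simpa using h τ
  rw [this]; rfl

lemma eval_dd {m : ℕ} (V Y : Fin (m + 3) → MvPolynomial (Fin (m + 3)) ℂ)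
    (I : Fin m → Fin (m + 3)) (z : Fin (m + 3) → ℂ) :
    eval z (dd V Y X (fun k => Pi.single (I k) 1)) =
      dd (fun i => eval z (V i)) (fun i => eval z (Y i)) z (fun k => Pi.single (I k) 1) := by
  rw [dd_map]
  congr 1
  · simp only [eval_X]
  · funext k i
    by_cases h : i = I k
    · subst h; simp
    · simp [h]

lemma ker_lemma {m : ℕ} (V : Fin (m + 3) → MvPolynomial (Fin (m + 3)) ℂ)
    (hcop : ∀ p : MvPolynomial (Fin (m + 3)) ℂ, Irreducible p →
      ∃ s : Fin (m + 3) × Fin (m + 3), ¬ p ∣ V s.1 * X s.2 - V s.2 * X s.1)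
    (Y : Fin (m + 3) → MvPolynomial (Fin (m + 3)) ℂ)
    (hY : ∀ I : Fin m → Fin (m + 3), dd V Y X (fun k => Pi.single (I k) 1) = 0) :
    ∃ a b : MvPolynomial (Fin (m + 3)) ℂ, Y = a • V + b • X := by
  have hid : ∀ p q : Fin (m + 3) × Fin (m + 3),
      (V p.1 * X p.2 - V p.2 * X p.1) * (Y q.1 * X q.2 - Y q.2 * X q.1) =
      (V q.1 * X q.2 - V q.2 * X q.1) * (Y p.1 * X p.2 - Y p.2 * X p.1) := by
    intro p q
    apply MvPolynomial.funext
    intro z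
    have h0 : ∀ v, dd (fun i => eval z (V i)) (fun i => eval z (Y i)) z v = 0 := by
      apply dd_ext_zero
      intro I
      rw [← eval_dd, hY, map_zero]
    have h1 := dd_dep _ _ _ h0
    rw [Fintype.not_linearIndependent_iff] at h1
    obtain ⟨c, hc, hne⟩ := h1
    simp only [Fin.sum_univ_three] at hc
    have hc' : ∀ i, c 0 * eval z (V i) + c 1 * eval z (Y i) + c 2 * z i = 0 := by
      intro i
      simpa using congrFun hc i
    simp only [map_mul, map_sub, eval_X]
    have hp : c 0 * (eval z (V p.1) * z p.2 - eval z (V p.2) * z p.1) +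
        c 1 * (eval z (Y p.1) * z p.2 - eval z (Y p.2) * z p.1) = 0 := by
      linear_combination z p.2 * hc' p.1 - z p.1 * hc' p.2
    have hq : c 0 * (eval z (V q.1) * z q.2 - eval z (V q.2) * z q.1) +
        c 1 * (eval z (Y q.1) * z q.2 - eval z (Y q.2) * z q.1) = 0 := by
      linear_combination z q.2 * hc' q.1 - z q.1 * hc' q.2
    generalize eval z (V p.1) * z p.2 - eval z (V p.2) * z p.1 = A at *
    generalize eval z (V q.1) * z q.2 - eval z (V q.2) * z q.1 = B at *
    by_cases h00 : c 0 = 0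
    · by_cases h11 : c 1 = 0
      · have h2 : c 2 ≠ 0 := by
          intro h22
          obtain ⟨i, hi⟩ := hne
          fin_cases i <;> simp_all
        have hz : ∀ i, z i = 0 := by
          intro i
          have := hc' i
          rw [h00, h11] at this
          simpa [h2] using this
        simp [hz]
      · refine mul_left_cancel₀ h11 ?_
        linear_combination A * hq - B * hp
    · refine mul_left_cancel₀ h00 ?_
      linear_combination (eval z (Y q.1) * z q.2 - eval z (Y q.2) * z q.1) * hp -
        (eval z (Y p.1) * z p.2 - eval z (Y p.2) * z p.1) * hq
  obtain ⟨a, ha⟩ := ufd_prop (fun s : Fin (m + 3) × Fin (m + 3) => V s.1 * X s.2 - V s.2 * X s.1)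
    (fun s => Y s.1 * X s.2 - Y s.2 * X s.1) (fun p q => hid p q) hcop (by
      obtain ⟨s, hs⟩ := hcop (X 0) (X_prime (i := 0)).irreducible
      exact ⟨s, fun h => hs (by rw [h]; exact dvd_zero _)⟩)
  obtain ⟨b, hb⟩ := ufd_prop (fun i : Fin (m + 3) => (X i : MvPolynomial (Fin (m + 3)) ℂ))
    (fun i => Y i - a * V i) (fun i j => by
      have := ha (i, j)
      simp only at this
      linear_combination -this) (by
      intro p hp
      by_contra hcon
      push Not at hcon
      have h0 : (X 0 : MvPolynomial (Fin (m + 3)) ℂ) ∣ p :=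
        (hp.associated_of_dvd (X_prime (i := 0)).irreducible (hcon 0)).symm.dvd
      have := X_dvd_X.1 (h0.trans (hcon 1))
      simp [Fin.ext_iff] at this) ⟨0, X_ne_zero 0⟩
  refine ⟨a, b, ?_⟩
  funext i
  have := hb i
  simp only [Pi.add_apply, Pi.smul_apply, smul_eq_mul]
  linear_combination this

lemma ind_lemma {m : ℕ} (V : Fin (m + 3) → MvPolynomial (Fin (m + 3)) ℂ)
    (hcop : ∀ p : MvPolynomial (Fin (m + 3)) ℂ, Irreducible p →
      ∃ s : Fin (m + 3) × Fin (m + 3), ¬ p ∣ V s.1 * X s.2 - V s.2 * X s.1)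
    (a b : MvPolynomial (Fin (m + 3)) ℂ) (h : a • V + b • X = 0) : a = 0 ∧ b = 0 := by
  obtain ⟨s, hs⟩ := hcop (X 0) (X_prime (i := 0)).irreducible
  have hne : V s.1 * X s.2 - V s.2 * X s.1 ≠ 0 := fun h => hs (by rw [h]; exact dvd_zero _)
  have h' : ∀ i, a * V i + b * X i = 0 := fun i => by simpa using congrFun h i
  have ha : a = 0 := by
    have : a * (V s.1 * X s.2 - V s.2 * X s.1) = 0 := by
      linear_combination X s.2 * h' s.1 - X s.1 * h' s.2
    exact (mul_eq_zero.1 this).resolve_right hne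
  refine ⟨ha, ?_⟩
  have := h' 0
  rw [ha, zero_mul, zero_add] at this
  exact (mul_eq_zero.1 this).resolve_right (X_ne_zero 0)

/-- the linear map `Y ↦ (det (V, Y, X, e_I))_I` -/
noncomputable def phi {m : ℕ} (V : Fin (m + 3) → MvPolynomial (Fin (m + 3)) ℂ) :
    (Fin (m + 3) → MvPolynomial (Fin (m + 3)) ℂ) →ₗ[MvPolynomial (Fin (m + 3)) ℂ]
      ((Fin m → Fin (m + 3)) → MvPolynomial (Fin (m + 3)) ℂ) :=
  Matrix.mulVecLin (Matrix.of fun I j => dd V (Pi.single j 1) X (fun k => Pi.single (I k) 1))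

lemma phi_apply {m : ℕ} (V Y : Fin (m + 3) → MvPolynomial (Fin (m + 3)) ℂ)
    (I : Fin m → Fin (m + 3)) : phi V Y I = dd V Y X (fun k => Pi.single (I k) 1) := by
  rw [dd_linear]; rfl

lemma mem_smul_top_pi {R J : Type*} [CommRing R] [Fintype J] (A : Ideal R) (w : J → R)
    (h : ∀ j, w j ∈ A) : w ∈ A • (⊤ : Submodule R (J → R)) := by
  classical
  have : w = ∑ j, w j • (Pi.single j (1 : R) : J → R) := by
    ext t
    simp [Finset.sum_apply, Pi.single_apply]
  rw [this]
  exact Submodule.sum_mem _ fun j _ => Submodule.smul_mem_smul (h j) trivial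

/-- The polynomial core of the argument. -/
lemma core {m : ℕ} (V : Fin (m + 3) → MvPolynomial (Fin (m + 3)) ℂ)
    (hcop : ∀ p : MvPolynomial (Fin (m + 3)) ℂ, Irreducible p →
      ∃ s : Fin (m + 3) × Fin (m + 3), ¬ p ∣ V s.1 * X s.2 - V s.2 * X s.1)
    (w : (Fin m → Fin (m + 3)) → MvPolynomial (Fin (m + 3)) ℂ)
    (hloc : ∀ q : Fin (m + 3) → ℂ, q ≠ 0 → ∃ Y : Fin (m + 3) → (Fin (m + 3) → ℂ) → ℂ,
      (∀ j, AnalyticAt ℂ (Y j) q) ∧ ∀ᶠ z in 𝓝 q, ∀ I,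
        eval z (w I) = dd (fun i => eval z (V i)) (fun i => Y i z) z (fun k => Pi.single (I k) 1)) :
    ∃ Y, phi V Y = w := by
  obtain ⟨r, hr⟩ := local_to_power (LinearMap.range (phi V)) w (by
    intro q hq k
    obtain ⟨Y, hYa, hYe⟩ := hloc q hq
    choose T hT using fun j => taylor (Y j) q (hYa j) k
    let T' : Fin (m + 3) → MvPolynomial (Fin (m + 3)) ℂ := fun j => aeval (fun i => X i - C (q i)) (T j)
    have hT' : ∀ j y, eval (q + y) (T' j) = eval y (T j) := by
      intro j y
      have : (eval (q + y)).comp (aeval (fun i => X i - C (q i)) :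
          MvPolynomial (Fin (m + 3)) ℂ →ₐ[ℂ] MvPolynomial (Fin (m + 3)) ℂ).toRingHom = eval y := by
        ext i <;> simp
      exact congrArg (fun g : MvPolynomial (Fin (m + 3)) ℂ →+* ℂ => g (T j)) this
    refine ⟨phi V T', ⟨T', rfl⟩, mem_smul_top_pi _ _ fun I => order_mem _ q k ?_⟩
    have hev : ∀ᶠ y in 𝓝 (0 : Fin (m + 3) → ℂ), ∀ I,
        eval (q + y) (w I) = dd (fun i => eval (q + y) (V i)) (fun i => Y i (q + y)) (q + y)
          (fun k => Pi.single (I k) 1) := by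
      have ht : Tendsto (fun y : Fin (m + 3) → ℂ => q + y) (𝓝 0) (𝓝 q) := by
        have : Tendsto (fun y : Fin (m + 3) → ℂ => q + y) (𝓝 0) (𝓝 (q + 0)) :=
          (continuous_const.add continuous_id).tendsto 0
        rwa [add_zero] at this
      exact ht.eventually hYe
    have hsum : (fun y : Fin (m + 3) → ℂ => ∑ j, dd (fun i => eval (q + y) (V i)) (Pi.single j 1) (q + y)
          (fun k => Pi.single (I k) 1) * (Y j (q + y) - eval y (T j)))
        =O[𝓝 (0 : Fin (m + 3) → ℂ)] fun y : Fin (m + 3) → ℂ => ‖y‖ ^ k := by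
      apply Asymptotics.IsBigO.fun_sum
      intro j _
      have hb : (fun y => dd (fun i => eval (q + y) (V i)) (Pi.single j 1) (q + y)
          (fun k => Pi.single (I k) (1 : ℂ))) =O[𝓝 (0 : Fin (m + 3) → ℂ)] fun _ => (1 : ℝ) := by
        have he : (fun y => dd (fun i => eval (q + y) (V i)) (Pi.single j 1) (q + y)
          (fun k => Pi.single (I k) (1 : ℂ))) = fun y =>
            eval (q + y) (dd V (Pi.single j 1) X (fun k => Pi.single (I k) 1)) := by
          funext y
          rw [eval_dd]
          congr 2
          funext i
          by_cases h : i = j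
          · subst h; simp
          · simp [h]
        rw [he]
        have hcont : Continuous fun y : Fin (m + 3) → ℂ =>
            eval (q + y) (dd V (Pi.single j 1) X (fun k => Pi.single (I k) 1)) :=
          (MvPolynomial.continuous_eval _).comp (continuous_const.add continuous_id)
        exact (hcont.tendsto 0).isBigO_one ℝ
      simpa using hb.mul (hT j)
    refine hsum.congr' ?_ EventuallyEq.rfl
    filter_upwards [hev] with y hy
    rw [Pi.sub_apply, map_sub, hy I, phi_apply, eval_dd, dd_linear]
    rw [dd_linear (fun i => eval (q + y) (V i)) (fun i => eval (q + y) (T' i)), ← Finset.sum_sub_distrib]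
    refine Finset.sum_congr rfl fun j _ => ?_
    rw [hT', mul_sub])
  refine koszul (0 : Fin (m + 3)) 1 2 (by simp [Fin.ext_iff])
    (fun h => by
      have := congrArg Fin.val h
      simp at this
      rw [Nat.mod_eq_of_lt (by omega)] at this
      omega) ?_ (phi V) V X ?_ ?_ ?_
    (ind_lemma V hcop) w r hr
  · intro h
    have := congrArg Fin.val h
    simp at this
    rw [Nat.mod_eq_of_lt (by omega)] at this
    omega
  · funext I; rw [phi_apply]; exact dd_self_left _ _ _
  · funext I; rw [phi_apply]; exact dd_self_right _ _ _
  · intro Y hY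
    refine ker_lemma V hcop Y fun I => ?_
    rw [← phi_apply, hY]; rfl

/-- homogeneous components of a product with a homogeneous polynomial -/
lemma hc_mul {N e k : ℕ} {c : MvPolynomial (Fin N) ℂ} (hc : c.IsHomogeneous e)
    (y : MvPolynomial (Fin N) ℂ) (hk : e ≤ k) :
    homogeneousComponent k (c * y) = c * homogeneousComponent (k - e) y := by
  apply MvPolynomial.funext
  intro z
  rw [← line_coeff, map_mul, ← line_coeff]
  have : line (c * y) z = Polynomial.C (eval z c) * Polynomial.X ^ e * line y z := by
    apply Polynomial.funext
    intro t
    simp only [line_eval, Polynomial.eval_mul, Polynomial.eval_C, Polynomial.eval_pow,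
      Polynomial.eval_X, map_mul, homog_eval hc]
    ring
  rw [this, mul_assoc, Polynomial.coeff_C_mul, Polynomial.coeff_X_pow_mul', if_pos hk]

lemma hc_mul_lt {N e k : ℕ} {c : MvPolynomial (Fin N) ℂ} (hc : c.IsHomogeneous e)
    (y : MvPolynomial (Fin N) ℂ) (hk : k < e) :
    homogeneousComponent k (c * y) = 0 := by
  apply MvPolynomial.funext
  intro z
  rw [← line_coeff, map_zero]
  have : line (c * y) z = Polynomial.C (eval z c) * Polynomial.X ^ e * line y z := by
    apply Polynomial.funext
    intro t
    simp only [line_eval, Polynomial.eval_mul, Polynomial.eval_C, Polynomial.eval_pow,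
      Polynomial.eval_X, map_mul, homog_eval hc]
    ring
  rw [this, mul_assoc, Polynomial.coeff_C_mul, Polynomial.coeff_X_pow_mul', if_neg (by omega), mul_zero]

lemma dd_smul {m : ℕ} (V Y Z : Fin (m + 3) → ℂ) (a b : ℂ) (v : Fin m → Fin (m + 3) → ℂ) :
    dd (a • V) Y (b • Z) v = a * b * dd V Y Z v := by
  simp [dd, map_smul, AlternatingMap.curryLeft_smul]
  ring

lemma coef_homog {m e : ℕ} (V : Fin (m + 3) → MvPolynomial (Fin (m + 3)) ℂ)
    (hV : ∀ i, (V i).IsHomogeneous e) (j : Fin (m + 3)) (I : Fin m → Fin (m + 3)) :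
    (dd V (Pi.single j 1) X (fun k => Pi.single (I k) 1)).IsHomogeneous (e + 1) := by
  obtain ⟨P, hP, hPe⟩ := homog_poly
    (fun z => eval z (dd V (Pi.single j 1) X (fun k => Pi.single (I k) 1))) (e + 1)
    (AnalyticOnNhd.eval_mvPolynomial _ 0 trivial) (by
      intro t z
      rw [eval_dd, eval_dd]
      have h1 : (fun i => eval (t • z) (V i)) = t ^ e • fun i => eval z (V i) := by
        funext i; simp [homog_eval (hV i)]
      have h2 : (fun i => eval (t • z) ((Pi.single j 1 : Fin (m + 3) → MvPolynomial (Fin (m + 3)) ℂ) i)) =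
          fun i => eval z ((Pi.single j 1 : Fin (m + 3) → MvPolynomial (Fin (m + 3)) ℂ) i) := by
        funext i
        by_cases h : i = j
        · subst h; simp
        · simp [h]
      rw [h1, h2, dd_smul]
      ring)
  have : P = dd V (Pi.single j 1) X (fun k => Pi.single (I k) 1) :=
    MvPolynomial.funext fun z => hPe z
  rw [← this]; exact hP

lemma main_poly {m e d : ℕ} (V : Fin (m + 3) → MvPolynomial (Fin (m + 3)) ℂ)
    (hV : ∀ i, (V i).IsHomogeneous e)
    (w : (Fin m → Fin (m + 3)) → MvPolynomial (Fin (m + 3)) ℂ)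
    (hw : ∀ I, (w I).IsHomogeneous (d + 1)) (hw0 : w ≠ 0)
    (Y : Fin (m + 3) → MvPolynomial (Fin (m + 3)) ℂ) (hY : phi V Y = w) :
    e ≤ d ∧ ∃ Y' : Fin (m + 3) → MvPolynomial (Fin (m + 3)) ℂ,
      (∀ i, (Y' i).IsHomogeneous (d - e)) ∧ phi V Y' = w := by
  have hI : ∀ I, w I = ∑ j, homogeneousComponent (d + 1)
      (dd V (Pi.single j 1) X (fun k => Pi.single (I k) 1) * Y j) := by
    intro I
    rw [← map_sum, ← dd_linear, ← phi_apply, hY]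
    exact (homogeneousComponent_eq_self (hw I)).symm
  by_cases hde : e ≤ d
  · refine ⟨hde, fun j => homogeneousComponent (d - e) (Y j),
      fun j => homogeneousComponent_isHomogeneous _ _, ?_⟩
    funext I
    rw [phi_apply, dd_linear, hI I]
    refine Finset.sum_congr rfl fun j _ => ?_
    rw [hc_mul (coef_homog V hV j I) _ (by omega)]
    congr 3
    omega
  · exfalso
    apply hw0
    funext I
    rw [hI I]
    exact Finset.sum_eq_zero fun j _ => hc_mul_lt (coef_homog V hV j I) _ (by omega)

end S5

namespace S5
open MvPolynomial

lemma CodimGE_mono {n c : ℕ} {A B : Set (Cn n)} (h : A ⊆ B) (hB : CodimGE n B c) :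
    CodimGE n A c := by
  rcases hB with hB | hB
  · left
    exact subset_empty_iff.1 (hB ▸ h)
  · right
    exact le_trans (add_le_add_left (dimH_mono h) _) hB

lemma hyp_not_codim' {m : ℕ} (g : MvPolynomial (Fin (m + 3)) ℂ) (hg : g ≠ 0) (hu : ¬ IsUnit g)
    (h : CodimGE (m + 3) {z : Fin (m + 3) → ℂ | z ≠ 0 ∧ eval z g = 0} 2) : False := by
  have h1 := hyp_not_codim (N := m + 1) g hg hu
  rcases h with h | h
  · rw [show {z : Fin (m + 1 + 2) → ℂ | z ≠ 0 ∧ eval z g = 0} = ∅ from h, dimH_empty] at h1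
    norm_cast at h1
  · have h2 := le_trans (add_le_add_left h1 (2 * ((2 : ℕ) : ℝ≥0∞))) h
    norm_cast at h2
    omega

lemma span_of_minors {N : ℕ} (V z : Fin N → ℂ) (hz : z ≠ 0)
    (h : ∀ i j, V i * z j - V j * z i = 0) : V ∈ Submodule.span ℂ {z} := by
  obtain ⟨j, hj⟩ := Function.ne_iff.1 hz
  rw [Submodule.mem_span_singleton]
  refine ⟨V j / z j, ?_⟩
  funext i
  have := h i j
  have hj' : z j ≠ 0 := hj
  simp only [Pi.smul_apply, smul_eq_mul]
  field_simp
  linear_combination -this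

lemma main_thm (m : ℕ) (D : ProjDist (m + 2) 2) (G : ProjFol1 (m + 2))
    (hdiv : ∀ q : Cn (m + 2 + 1), q ≠ 0 → PLocDividesAt G D q) (hn : m + 2 + 1 = 3 + m) :
    ∃ H : ProjFol1 (m + 2), PTangent H D ∧ D.d = G.d + H.d ∧ SplitPair hn G H D := by
  have hVc : ∀ j : Fin (m + 3), ∃ P : MvPolynomial (Fin (m + 3)) ℂ, P.IsHomogeneous G.d ∧
      ∀ z, eval z P = G.V z j := by
    intro j
    refine homog_poly (fun z => G.V z j) G.d ?_ ?_
    · exact (analyticAt_pi_iff.1 (G.hol 0 (mem_univ _))) j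
    · intro t z
      rw [G.homog]; rfl
  choose Vp hVh hVe using hVc
  have hVe' : ∀ z, (fun i => eval z (Vp i)) = G.V z := fun z => funext fun i => hVe i z
  let ω : Cn (m + 3) → AlternatingMap ℂ (Cn (m + 3)) ℂ (Fin m) := D.ω
  have hwc : ∀ I : Fin m → Fin (m + 3), ∃ P : MvPolynomial (Fin (m + 3)) ℂ,
      P.IsHomogeneous (D.d + 1) ∧ ∀ z, eval z P = ω z (fun k => Pi.single (I k) 1) := by
    intro I
    exact homog_poly (fun z => ω z (fun k => Pi.single (I k) 1)) (D.d + 1)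
      (D.hol _ 0 (mem_univ _)) (fun t z => D.homog t z _)
  choose w hwh hwe using hwc
  have hω0 : ∀ z, (∀ I : Fin m → Fin (m + 3), ω z (fun k => Pi.single (I k) 1) = 0) → ω z = 0 := by
    intro z hz
    refine Module.Basis.ext_alternating (Pi.basisFun ℂ (Fin (m + 3))) fun τ _ => ?_
    simpa using hz τ
  have hw0 : w ≠ 0 := by
    intro h
    refine hyp_not_codim' (X 0 : MvPolynomial (Fin (m + 3)) ℂ) (X_ne_zero _)
      (fun hu => by simpa using hu.map (eval (0 : Fin (m + 3) → ℂ))) (CodimGE_mono ?_ D.codim)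
    rintro z ⟨hz, -⟩
    refine ⟨hz, hω0 z fun I => ?_⟩
    rw [← hwe, h]; simp
  have hcop : ∀ p : MvPolynomial (Fin (m + 3)) ℂ, Irreducible p →
      ∃ s : Fin (m + 3) × Fin (m + 3), ¬ p ∣ Vp s.1 * X s.2 - Vp s.2 * X s.1 := by
    intro p hp
    by_contra hcon
    push Not at hcon
    refine hyp_not_codim' p hp.ne_zero hp.not_isUnit (CodimGE_mono ?_ G.codim)
    rintro z ⟨hz, hpz⟩
    refine ⟨hz, span_of_minors _ _ hz fun i j => ?_⟩
    obtain ⟨a, ha⟩ := hcon (i, j)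
    have := congrArg (eval z) ha
    simp only [map_sub, map_mul, eval_X, hVe, hpz, zero_mul] at this
    exact this
  have hloc : ∀ q : Fin (m + 3) → ℂ, q ≠ 0 → ∃ Y : Fin (m + 3) → (Fin (m + 3) → ℂ) → ℂ,
      (∀ j, AnalyticAt ℂ (Y j) q) ∧ ∀ᶠ z in 𝓝 q, ∀ I,
        eval z (w I) = dd (fun i => eval z (Vp i)) (fun i => Y i z) z
          (fun k => Pi.single (I k) 1) := by
    intro q hq
    obtain ⟨Θ, hΘ, hev⟩ := hdiv q hq
    let Θ' : Cn (m + 3) → AlternatingMap ℂ (Fin (m + 2 + 1) → ℂ) ℂ (Fin (m + 2)) := Θ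
    refine ⟨fun j z => -((-1) ^ (j : ℕ) * Θ' z (fun i => Pi.single (j.succAbove i) 1)), ?_, ?_⟩
    · intro j
      exact (analyticAt_const.mul (hΘ _)).neg
    · filter_upwards [hev] with z hz I
      rw [hwe]
      have h1 : ω z (fun k => Pi.single (I k) 1) =
        Θ' z (Fin.cons (G.V z) (Fin.cons z (fun k => Pi.single (I k) 1))) := hz _
      rw [h1, theta, hVe']
      have h2 := dd_swap (G.V z)
        (fun j => -((-1) ^ (j : ℕ) * Θ' z (fun i => Pi.single (j.succAbove i) 1))) z
        (fun k => Pi.single (I k) (1 : ℂ))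
      have h3 : ∀ (Y V Z : Fin (m + 3) → ℂ) v, dd (fun j => - Y j) V Z v = - dd Y V Z v := by
        intro Y V Z v
        have := dd_smul Y V Z (-1) 1 v
        rw [one_smul, neg_smul, one_smul, mul_one, neg_one_mul] at this
        exact this
      rw [h3] at h2
      exact neg_injective h2
  obtain ⟨Y0, hY0⟩ := core Vp hcop w hloc
  obtain ⟨hed, Y, hYh, hY⟩ := main_poly Vp hVh w hwh hw0 Y0 hY0
  have key : ∀ z v, ω z v = dd (G.V z) (fun i => eval z (Y i)) z v := by
    intro z v
    have : ω z = dd (G.V z) (fun i => eval z (Y i)) z := by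
      refine Module.Basis.ext_alternating (Pi.basisFun ℂ (Fin (m + 3))) fun τ _ => ?_
      have h := hwe τ z
      rw [← hY, phi_apply, eval_dd, hVe'] at h
      simpa using h.symm
    rw [this]
  refine ⟨⟨D.d - G.d, fun z i => eval z (Y i), ?_, ?_, ?_⟩, ?_, ?_, ?_⟩
  · intro z _
    rw [analyticAt_pi_iff]
    intro i
    exact AnalyticOnNhd.eval_mvPolynomial (Y i) z (mem_univ _)
  · intro t z
    funext i
    exact homog_eval (hYh i) t z
  · refine CodimGE_mono ?_ D.codim
    rintro z ⟨hz, hs⟩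
    refine ⟨hz, hω0 z fun I => ?_⟩
    rw [key]
    obtain ⟨c, hc⟩ := Submodule.mem_span_singleton.1 hs
    rw [← hc]
    have h1 := dd_swap (c • z) (G.V z) z (fun k => Pi.single (I k) (1 : ℂ))
    have h2 := dd_smul z (G.V z) z c 1 (fun k => Pi.single (I k) (1 : ℂ))
    rw [one_smul, dd_swap (G.V z) z, dd_self_right] at h2
    rw [h1, h2]; simp
  · intro z v i h
    exact (key z v).trans (dd_mem _ _ _ _ i h)
  · exact (Nat.add_sub_cancel' hed).symm
  · refine ⟨1, one_ne_zero, fun z v => ?_⟩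
    rw [one_mul]
    refine (key z v).trans ?_
    rw [dd_apply, ← append_eq hn]

end S5

/-- Proposition 3.6: If a one-dimensional foliation `G` on `ℙⁿ`,
`n ≥ 3`, locally divides a two-dimensional distribution `D` at every point, then there
is a one-dimensional foliation `H` tangent to `D` with `T_D = T_G ⊕ T_H`; in particular
`T_D ≅ O(1-e) ⊕ O(1+e-d)` where `d = deg D`, `e = deg G` (encoded by
`deg D = deg G + deg H`). -/
theorem statement_5 (n : ℕ) (hn : 3 ≤ n) (D : ProjDist n 2) (G : ProjFol1 n)
    (hdiv : ∀ q : Cn (n + 1), q ≠ 0 → PLocDividesAt G D q) :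
    ∃ H : ProjFol1 n, PTangent H D ∧ D.d = G.d + H.d ∧ SplitPair (by omega) G H D := by
  obtain ⟨m, rfl⟩ : ∃ m, n = m + 2 := ⟨n - 2, by omega⟩
  exact S5.main_thm m D G hdiv _
end
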